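/- arXiv:1609.07315 — 3 statements merged into one kernel-verified Lean document; each statement's English description precedes it below -/
import Mathlib

section
/- Let G be an ℓ-local subgroup of S_n, μ₀ the uniform probability measure on G, and c² = 2(ℓ−1)² + 2. Let g : G → ℝ be a configuration function: there exist α_k : G → [0,∞), k ∈ {1,…,n}, with g(τ) − g(σ) ≤ ∑_{k=1}^n α_k(τ)·1_{τ(k)≠σ(k)} for all σ,τ ∈ G. Write |α(σ)|₂² = ∑_{k=1}^n α_k(σ)² and μ₀(g) = ∑_σ g(σ)μ₀(σ). Then for all u ≥ 0: μ₀( g ≤ μ₀(g) − u ) ≤ exp( −u² / ( 2c²·∑_σ |α(σ)|₂²μ₀(σ) ) ), μ₀( g ≥ μ₀(g) + u ) ≤ exp( −u² / ( 2c²·sup_{σ∈G} |α(σ)|₂² ) ), and if there exists M ≥ 0 with |α(σ)|₂² ≤ M·g(σ) for all σ, then μ₀( g ≥ μ₀(g) + u ) ≤ exp( −u² / ( 2c²M(μ₀(g)+u) ) ). -/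
attribute [local instance] Classical.propDecidable

noncomputable section

/-- Degree (cardinality of the support) of a permutation. -/
noncomputable def degree {n : ℕ} (σ : Equiv.Perm (Fin n)) : ℕ :=
  (Finset.univ.filter fun i => σ i ≠ i).card

/-- `G` is an `ℓ`-local group of permutations. -/
def IsLLocal {n : ℕ} (ℓ : ℕ) (G : Subgroup (Equiv.Perm (Fin n))) : Prop :=
  ∀ σ ∈ G, ∀ i j : Fin n, σ i = j →
    ∃ τ ∈ G, {x | τ x ≠ x} ⊆ {x | σ x ≠ x} ∧ degree τ ≤ ℓ ∧ τ i = j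

/-- The uniform probability measure on `G`. -/
noncomputable def unif {n : ℕ} (G : Subgroup (Equiv.Perm (Fin n))) :
    Equiv.Perm (Fin n) → ℝ :=
  fun σ => if σ ∈ G then (Nat.card G : ℝ)⁻¹ else 0

section
open Finset

theorem weighted_chebyshev {ι : Type*} [Fintype ι] (w φ ψ : ι → ℝ) (hw : ∀ i, 0 ≤ w i)
    (h : ∀ i j, 0 ≤ (φ i - φ j) * (ψ i - ψ j)) :
    (∑ i, w i * φ i) * (∑ i, w i * ψ i) ≤ (∑ i, w i) * ∑ i, w i * (φ i * ψ i) := by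
  have h0 : 0 ≤ ∑ i, ∑ j, w i * w j * ((φ i - φ j) * (ψ i - ψ j)) :=
    sum_nonneg fun i _ => sum_nonneg fun j _ => mul_nonneg (mul_nonneg (hw i) (hw j)) (h i j)
  have h1 : ∑ i, ∑ j, w i * w j * ((φ i - φ j) * (ψ i - ψ j)) =
      2 * ((∑ i, w i) * ∑ i, w i * (φ i * ψ i)) -
        2 * ((∑ i, w i * φ i) * (∑ i, w i * ψ i)) := by
    have e : ∀ i j, w i * w j * ((φ i - φ j) * (ψ i - ψ j)) =
        w j * (w i * (φ i * ψ i)) + w i * (w j * (φ j * ψ j)) -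
          (w i * φ i) * (w j * ψ j) - (w i * ψ i) * (w j * φ j) := fun i j => by ring
    simp only [e, sum_sub_distrib, sum_add_distrib, ← mul_sum, ← sum_mul]
    ring
  linarith

/-- Partition function `∑ᵢ pᵢ exp (s fᵢ)`. -/
def partitionFn {ι : Type*} [Fintype ι] (p f : ι → ℝ) (s : ℝ) : ℝ :=
  ∑ i, p i * Real.exp (s * f i)

theorem partitionFn_pos {ι : Type*} [Fintype ι] {p : ι → ℝ} (hp : ∀ i, 0 ≤ p i)
    (hp1 : ∑ i, p i = 1) (f : ι → ℝ) (s : ℝ) : 0 < partitionFn p f s := by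
  obtain ⟨i, -, hi⟩ : ∃ i ∈ univ, p i ≠ 0 := exists_ne_zero_of_sum_ne_zero (by simp [hp1])
  exact sum_pos' (fun j _ => mul_nonneg (hp j) (Real.exp_pos _).le)
    ⟨i, mem_univ i, mul_pos ((hp i).lt_of_ne' hi) (Real.exp_pos _)⟩

theorem tilted_mean_mono {ι : Type*} [Fintype ι] {p : ι → ℝ} (hp : ∀ i, 0 ≤ p i)
    {f φ : ι → ℝ} (hφ : ∀ i j, f i ≤ f j → φ i ≤ φ j) {s t : ℝ}
    (hst : s ≤ t) :
    (∑ i, p i * Real.exp (s * f i) * φ i) * partitionFn p f t ≤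
      partitionFn p f s * ∑ i, p i * Real.exp (t * f i) * φ i := by
  have h := weighted_chebyshev (fun i => p i * Real.exp (s * f i)) φ
    (fun i => Real.exp ((t - s) * f i)) (fun i => mul_nonneg (hp i) (Real.exp_pos _).le) ?_
  · have e : ∀ i, Real.exp (s * f i) * Real.exp ((t - s) * f i) = Real.exp (t * f i) := fun i => by
      rw [← Real.exp_add]; ring_nf
    have e1 : ∀ i, p i * Real.exp (s * f i) * Real.exp ((t - s) * f i) =
        p i * Real.exp (t * f i) := fun i => by rw [mul_assoc, e]
    have e2 : ∀ i, p i * Real.exp (s * f i) * (φ i * Real.exp ((t - s) * f i)) =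
        p i * Real.exp (t * f i) * φ i := fun i => by rw [← e1]; ring
    simpa only [e1, e2, partitionFn] using h
  · intro i j
    rcases le_total (f i) (f j) with hij | hij
    · exact mul_nonneg_of_nonpos_of_nonpos (by linarith [hφ i j hij]) (sub_nonpos.2
        (Real.exp_le_exp.2 (mul_le_mul_of_nonneg_left hij (by linarith))))
    · exact mul_nonneg (by linarith [hφ j i hij]) (sub_nonneg.2
        (Real.exp_le_exp.2 (mul_le_mul_of_nonneg_left hij (by linarith))))

/-- Mean of the squared upward differences of `f` from a `p`-distributed point to a point
distributed according to the tilt of `p` by `exp f`. -/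
def upwardEnergy {ι : Type*} [Fintype ι] (p f : ι → ℝ) : ℝ :=
  ∑ i, p i * ((∑ l, p l * Real.exp (f l) * max 0 (f l - f i) ^ 2) / partitionFn p f 1)

theorem tilted_variance_le {ι : Type*} [Fintype ι] {p : ι → ℝ} (hp : ∀ i, 0 ≤ p i)
    (hp1 : ∑ i, p i = 1) (f : ι → ℝ) {s : ℝ} (hs0 : 0 ≤ s) (hs1 : s ≤ 1) :
    (∑ i, p i * Real.exp (s * f i) * f i ^ 2) * partitionFn p f s -
      (∑ i, p i * Real.exp (s * f i) * f i) ^ 2 ≤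
      partitionFn p f s ^ 2 * upwardEnergy p f := by
  set w : ι → ℝ := fun i => p i * Real.exp (s * f i) with hw
  have hw0 : ∀ i, 0 ≤ w i := fun i => mul_nonneg (hp i) (Real.exp_pos _).le
  set ψ : ι → ℝ := fun i =>
    (∑ l, p l * Real.exp (f l) * max 0 (f l - f i) ^ 2) / partitionFn p f 1 with hψ
  have hZ1 := partitionFn_pos hp hp1 f 1
  have hZs := partitionFn_pos hp hp1 f s
  have hsq : (∑ i, w i * f i ^ 2) * partitionFn p f s - (∑ i, w i * f i) ^ 2 =
      ∑ i, w i * ∑ l, w l * max 0 (f l - f i) ^ 2 := by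
    have hsym : ∑ i, w i * ∑ l, w l * max 0 (f l - f i) ^ 2 =
        ∑ i, w i * ∑ l, w l * max 0 (f i - f l) ^ 2 := by
      simp only [mul_sum]
      rw [sum_comm]
      exact sum_congr rfl fun i _ => sum_congr rfl fun l _ => by ring
    have hadd : ∑ i, w i * ∑ l, w l * max 0 (f l - f i) ^ 2 +
        ∑ i, w i * ∑ l, w l * max 0 (f i - f l) ^ 2 =
        2 * ((∑ i, w i * f i ^ 2) * partitionFn p f s - (∑ i, w i * f i) ^ 2) := by
      have e : ∀ i l, w i * (w l * max 0 (f l - f i) ^ 2) + w i * (w l * max 0 (f i - f l) ^ 2) =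
          w i * (w l * f l ^ 2) + (w i * f i ^ 2) * w l - 2 * ((w i * f i) * (w l * f l)) := by
        intro i l
        rcases le_total (f i) (f l) with h | h
        · rw [max_eq_right (sub_nonneg.2 h), max_eq_left (sub_nonpos.2 h)]; ring
        · rw [max_eq_left (sub_nonpos.2 h), max_eq_right (sub_nonneg.2 h)]; ring
      have hZ : partitionFn p f s = ∑ i, w i := rfl
      simp only [mul_sum]
      simp only [← sum_add_distrib, e]
      simp only [sum_sub_distrib, sum_add_distrib, ← mul_sum, ← sum_mul]
      rw [hZ]; ring
    linarith
  rw [hsq]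
  have h1 : ∀ i, ∑ l, w l * max 0 (f l - f i) ^ 2 ≤ partitionFn p f s * ψ i := by
    intro i
    have h := tilted_mean_mono hp (f := f) (φ := fun l => max 0 (f l - f i) ^ 2)
      (fun a b hab => by gcongr) hs1
    simp only [one_mul] at h
    rw [hψ, ← mul_div_assoc, le_div_iff₀ hZ1]
    exact h
  have h2 : ∑ i, w i * ψ i ≤ partitionFn p f s * ∑ i, p i * ψ i := by
    have h := tilted_mean_mono hp (f := f) (φ := fun i => - ψ i) (fun a b hab => by
      simp only [hψ]
      rw [neg_le_neg_iff]
      have : ∀ l, 0 ≤ p l * Real.exp (f l) := fun l => mul_nonneg (hp l) (Real.exp_pos _).le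
      gcongr with l
      exact this l) hs0
    have hZ0 : partitionFn p f 0 = 1 := by simp [partitionFn, hp1]
    simp only [hZ0, mul_neg, sum_neg_distrib, zero_mul, Real.exp_zero, mul_one] at h
    linarith
  calc ∑ i, w i * ∑ l, w l * max 0 (f l - f i) ^ 2
      ≤ ∑ i, w i * (partitionFn p f s * ψ i) :=
        sum_le_sum fun i _ => mul_le_mul_of_nonneg_left (h1 i) (hw0 i)
    _ = partitionFn p f s * ∑ i, w i * ψ i := by
        rw [mul_sum]; exact sum_congr rfl fun i _ => by ring
    _ ≤ partitionFn p f s * (partitionFn p f s * ∑ i, p i * ψ i) := by gcongr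
    _ = partitionFn p f s ^ 2 * upwardEnergy p f := by simp only [upwardEnergy, hψ]; ring

theorem hasDerivAt_partitionFn {ι : Type*} [Fintype ι] (p f : ι → ℝ) (s : ℝ) :
    HasDerivAt (partitionFn p f) (∑ i, p i * Real.exp (s * f i) * f i) s := by
  have := HasDerivAt.fun_sum (u := univ) (A := fun i s => p i * Real.exp (s * f i))
    (A' := fun i => p i * (Real.exp (s * f i) * (1 * f i))) (x := s)
    fun i _ => (((hasDerivAt_id s).mul_const (f i)).exp).const_mul (p i)
  simp only [one_mul, ← mul_assoc] at this
  exact this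

theorem hasDerivAt_sum_mul_exp {ι : Type*} [Fintype ι] (p f : ι → ℝ) (s : ℝ) :
    HasDerivAt (fun s => ∑ i, p i * Real.exp (s * f i) * f i)
      (∑ i, p i * Real.exp (s * f i) * f i ^ 2) s := by
  have h := hasDerivAt_partitionFn (fun i => p i * f i) f s
  convert h using 1
  · ext s; exact sum_congr rfl fun i _ => by ring
  · exact sum_congr rfl fun i _ => by ring

theorem hasDerivAt_log_partitionFn {ι : Type*} [Fintype ι] {p : ι → ℝ} (hp : ∀ i, 0 ≤ p i)
    (hp1 : ∑ i, p i = 1) (f : ι → ℝ) (s : ℝ) :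
    HasDerivAt (fun s => Real.log (partitionFn p f s))
      ((∑ i, p i * Real.exp (s * f i) * f i) / partitionFn p f s) s :=
  (hasDerivAt_partitionFn p f s).log (partitionFn_pos hp hp1 f s).ne'

theorem hasDerivAt_tilted_mean {ι : Type*} [Fintype ι] {p : ι → ℝ} (hp : ∀ i, 0 ≤ p i)
    (hp1 : ∑ i, p i = 1) (f : ι → ℝ) (s : ℝ) :
    HasDerivAt (fun s => (∑ i, p i * Real.exp (s * f i) * f i) / partitionFn p f s)
      (((∑ i, p i * Real.exp (s * f i) * f i ^ 2) * partitionFn p f s -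
      (∑ i, p i * Real.exp (s * f i) * f i) ^ 2) / partitionFn p f s ^ 2) s := by
  have h := (hasDerivAt_sum_mul_exp p f s).div (hasDerivAt_partitionFn p f s)
    (partitionFn_pos hp hp1 f s).ne'
  rwa [← sq] at h

theorem le_of_hasDerivAt_nonpos {F F' : ℝ → ℝ} {a b : ℝ} (hab : a ≤ b)
    (hF : ∀ s, a ≤ s → s ≤ b → HasDerivAt F (F' s) s) (hF' : ∀ s, a ≤ s → s ≤ b → F' s ≤ 0) :
    F b ≤ F a := by
  refine antitoneOn_of_deriv_nonpos (convex_Icc a b)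
    (fun s hs => (hF s hs.1 hs.2).continuousAt.continuousWithinAt)
    (fun s hs => ?_) (fun s hs => ?_) (Set.left_mem_Icc.2 hab) (Set.right_mem_Icc.2 hab) hab
  all_goals rw [interior_Icc] at hs
  · exact (hF s hs.1.le hs.2.le).differentiableAt.differentiableWithinAt
  · rw [(hF s hs.1.le hs.2.le).deriv]; exact hF' s hs.1.le hs.2.le

theorem tilted_variance_div_le {ι : Type*} [Fintype ι] {p : ι → ℝ} (hp : ∀ i, 0 ≤ p i)
    (hp1 : ∑ i, p i = 1) (f : ι → ℝ) {s : ℝ} (hs0 : 0 ≤ s) (hs1 : s ≤ 1) :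
    ((∑ i, p i * Real.exp (s * f i) * f i ^ 2) * partitionFn p f s -
      (∑ i, p i * Real.exp (s * f i) * f i) ^ 2) / partitionFn p f s ^ 2 ≤ upwardEnergy p f := by
  rw [div_le_iff₀ (pow_pos (partitionFn_pos hp hp1 f s) 2)]
  linarith [tilted_variance_le hp hp1 f hs0 hs1]

theorem log_partitionFn_le {ι : Type*} [Fintype ι] {p : ι → ℝ} (hp : ∀ i, 0 ≤ p i)
    (hp1 : ∑ i, p i = 1) (f : ι → ℝ) :
    Real.log (partitionFn p f 1) ≤ ∑ i, p i * f i + 1 / 2 * upwardEnergy p f := by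
  have hZ0 : partitionFn p f 0 = 1 := by simp [partitionFn, hp1]
  set V := upwardEnergy p f
  have h1 : ∀ s, 0 ≤ s → s ≤ 1 → (∑ i, p i * Real.exp (s * f i) * f i) / partitionFn p f s ≤
      ∑ i, p i * f i + s * V := by
    intro s hs0 hs1
    have := le_of_hasDerivAt_nonpos hs0
      (F := fun s => (∑ i, p i * Real.exp (s * f i) * f i) / partitionFn p f s - s * V)
      (fun t _ _ => (hasDerivAt_tilted_mean hp hp1 f t).sub ((hasDerivAt_id t).mul_const V))
      (fun t ht0 ht1 => by linarith [tilted_variance_div_le hp hp1 f ht0 (ht1.trans hs1)])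
    simp only [hZ0, zero_mul, Real.exp_zero, mul_one, div_one, sub_zero] at this
    linarith
  have := le_of_hasDerivAt_nonpos zero_le_one
    (F := fun s => Real.log (partitionFn p f s) - (s * (∑ i, p i * f i) + s ^ 2 * (V / 2)))
    (fun t _ _ => (hasDerivAt_log_partitionFn hp hp1 f t).sub
      (((hasDerivAt_id t).mul_const _).add ((hasDerivAt_pow 2 t).mul_const _)))
    (fun t ht0 ht1 => by
      have := h1 t ht0 ht1
      push_cast
      simp only [pow_one]
      linarith)
  simp only [hZ0, Real.log_one] at this
  linarith

theorem entropy_le_upwardEnergy {ι : Type*} [Fintype ι] {p : ι → ℝ} (hp : ∀ i, 0 ≤ p i)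
    (hp1 : ∑ i, p i = 1) (f : ι → ℝ) :
    ∑ i, p i * Real.exp (f i) * f i - partitionFn p f 1 * Real.log (partitionFn p f 1) ≤
      1 / 2 * ∑ i, p i * ∑ l, p l * (Real.exp (f l) * max 0 (f l - f i) ^ 2) := by
  have hZ0 : partitionFn p f 0 = 1 := by simp [partitionFn, hp1]
  have hZ := partitionFn_pos hp hp1 f 1
  set V := upwardEnergy p f with hV
  have := le_of_hasDerivAt_nonpos zero_le_one
    (F := fun s => s * ((∑ i, p i * Real.exp (s * f i) * f i) / partitionFn p f s) -
      Real.log (partitionFn p f s) - s ^ 2 * (V / 2))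
    (fun t _ _ => (((hasDerivAt_id t).mul (hasDerivAt_tilted_mean hp hp1 f t)).sub
      (hasDerivAt_log_partitionFn hp hp1 f t)).sub ((hasDerivAt_pow 2 t).mul_const _))
    (fun t ht0 ht1 => by
      have := mul_le_mul_of_nonneg_left (tilted_variance_div_le hp hp1 f ht0 ht1) ht0
      push_cast
      simp only [pow_one, id]
      linarith)
  simp only [hZ0, Real.log_one, one_mul, zero_mul] at this
  have hE : ∑ i, p i * ∑ l, p l * (Real.exp (f l) * max 0 (f l - f i) ^ 2) =
      V * partitionFn p f 1 := by
    simp only [hV, upwardEnergy, ← mul_div_assoc, ← sum_div, div_mul_cancel₀ _ hZ.ne', mul_assoc]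
  rw [hE]
  have h3 : (∑ i, p i * Real.exp (f i) * f i) / partitionFn p f 1 ≤
      Real.log (partitionFn p f 1) + V / 2 := by linarith
  rw [div_le_iff₀ hZ] at h3
  linarith

theorem two_mul_pos_part_mul_sub_le (u v : ℝ) :
    2 * max 0 v * (u - v) ≤ max 0 u ^ 2 - max 0 v ^ 2 := by
  rcases max_cases 0 u with ⟨h, h'⟩ | ⟨h, h'⟩ <;> rcases max_cases 0 v with ⟨k, k'⟩ | ⟨k, k'⟩ <;>
    rw [h, k] <;> nlinarith [sq_nonneg (u - v)]

theorem partitionFn_mono {ι : Type*} [Fintype ι] {p : ι → ℝ} (hp : ∀ i, 0 ≤ p i)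
    {f g : ι → ℝ} (h : ∀ i, f i ≤ g i) : partitionFn p f 1 ≤ partitionFn p g 1 :=
  sum_le_sum fun i _ => mul_le_mul_of_nonneg_left
    (Real.exp_le_exp.2 (by linarith [h i])) (hp i)

theorem upwardEnergy_max_le {ι : Type*} [Fintype ι] {p : ι → ℝ} (hp : ∀ i, 0 ≤ p i)
    (hp1 : ∑ i, p i = 1) (f : ι → ℝ) (t : ℝ) :
    upwardEnergy p (fun i => max (f i) t) ≤ ∑ i, p i * ((∑ l, p l * Real.exp (f l) *
      max 0 (f l - max (f i) t) ^ 2) / partitionFn p f 1) := by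
  have hZ := partitionFn_pos hp hp1 f 1
  have hZ' : partitionFn p f 1 ≤ partitionFn p (fun i => max (f i) t) 1 :=
    partitionFn_mono hp fun i => le_max_left _ _
  refine sum_le_sum fun i _ => mul_le_mul_of_nonneg_left ?_ (hp i)
  have e : ∀ l, p l * Real.exp (max (f l) t) * max 0 (max (f l) t - max (f i) t) ^ 2 =
      p l * Real.exp (f l) * max 0 (f l - max (f i) t) ^ 2 := by
    intro l
    rcases le_total (f l) t with h | h
    · have h1 : t ≤ max (f i) t := le_max_right _ _
      rw [max_eq_right h, max_eq_left (by linarith), max_eq_left (by linarith)]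
      simp
    · rw [max_eq_left h]
  simp only [e]
  exact div_le_div_of_nonneg_left
    (sum_nonneg fun l _ => mul_nonneg (mul_nonneg (hp l) (Real.exp_pos _).le) (sq_nonneg _)) hZ hZ'

theorem exists_sum_mul_pos_part_eq_one {ι : Type*} [Fintype ι] {ν : ι → ℝ}
    (hν1 : ∑ i, ν i = 1) (hν : ∀ i, 0 ≤ ν i) (f : ι → ℝ) :
    ∃ t, ∑ l, ν l * max 0 (f l - t) = 1 := by
  have hc : Continuous fun t => ∑ l, ν l * max 0 (f l - t) := by fun_prop
  refine mem_range_of_exists_le_of_exists_ge hc ⟨∑ l, |f l|, ?_⟩ ⟨∑ l, ν l * f l - 1, ?_⟩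
  · have : ∀ l, max 0 (f l - ∑ l, |f l|) = 0 := fun l => max_eq_left (by
      have := single_le_sum (f := fun l => |f l|) (fun i _ => abs_nonneg _) (mem_univ l)
      linarith [le_abs_self (f l)])
    simp [this]
  · calc (1 : ℝ) = ∑ l, ν l * (f l - (∑ l, ν l * f l - 1)) := by
          simp only [mul_sub, sum_sub_distrib, ← sum_mul, hν1]; ring
      _ ≤ _ := sum_le_sum fun l _ => mul_le_mul_of_nonneg_left (le_max_right _ _) (hν l)

theorem log_partitionFn_le_of_config {ι : Type*} [Fintype ι] {p : ι → ℝ} (hp : ∀ i, 0 ≤ p i)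
    (hp1 : ∑ i, p i = 1) (f a : ι → ℝ) (b : ι → ι → ℝ)
    (hb : ∀ i l, p i ≠ 0 → p l ≠ 0 → 0 ≤ b i l)
    (ha : ∀ i, p i ≠ 0 → f i ≤ a i) (hab : ∀ i l, p i ≠ 0 → p l ≠ 0 → f l ≤ a i + b i l) :
    Real.log (partitionFn p f 1) ≤ ∑ i, p i * (a i + 1 / 2 *
      ((∑ l, p l * Real.exp (f l) * b i l ^ 2) / partitionFn p f 1)) := by
  have hZ := partitionFn_pos hp hp1 f 1
  set Z := partitionFn p f 1 with hZdef
  set ν : ι → ℝ := fun l => p l * Real.exp (f l) / Z with hνdef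
  have hν : ∀ l, 0 ≤ ν l := fun l => div_nonneg (mul_nonneg (hp l) (Real.exp_pos _).le) hZ.le
  have hν1 : ∑ l, ν l = 1 := by
    simp only [hνdef, ← sum_div]
    rw [div_eq_one_iff_eq hZ.ne', hZdef]
    simp [partitionFn]
  have hνsum : ∀ q : ι → ℝ, (∑ l, p l * Real.exp (f l) * q l) / Z = ∑ l, ν l * q l := fun q => by
    rw [sum_div]; exact sum_congr rfl fun l _ => by simp only [hνdef]; ring
  obtain ⟨t, ht⟩ := exists_sum_mul_pos_part_eq_one hν1 hν f
  have h1 : Real.log Z ≤ Real.log (partitionFn p (fun i => max (f i) t) 1) :=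
    Real.log_le_log hZ (partitionFn_mono hp fun i => le_max_left _ _)
  have h2 := log_partitionFn_le hp hp1 (fun i => max (f i) t)
  have h3 := upwardEnergy_max_le hp hp1 f t
  simp only [← hZdef, hνsum] at h3 ⊢
  refine (h1.trans h2).trans (le_trans (add_le_add_right (mul_le_mul_of_nonneg_left h3
    (by norm_num : (0:ℝ) ≤ 1 / 2)) _) ?_)
  rw [mul_sum, ← sum_add_distrib]
  refine sum_le_sum fun i _ => ?_
  rcases eq_or_ne (p i) 0 with hi | hi
  · simp [hi]
  set s := max (f i) t with hs
  have hmain : s + 1 / 2 * ∑ l, ν l * max 0 (f l - s) ^ 2 ≤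
      a i + 1 / 2 * ∑ l, ν l * max 0 (f l - a i) ^ 2 := by
    have hcv : 2 * (∑ l, ν l * max 0 (f l - s)) * (s - a i) ≤
        ∑ l, ν l * max 0 (f l - a i) ^ 2 - ∑ l, ν l * max 0 (f l - s) ^ 2 := by
      rw [mul_sum, sum_mul, ← sum_sub_distrib]
      refine sum_le_sum fun l _ => ?_
      have := mul_le_mul_of_nonneg_left (two_mul_pos_part_mul_sub_le (f l - a i) (f l - s)) (hν l)
      linarith
    have hφ : ∑ l, ν l * max 0 (f l - s) ≤ 1 := by
      rw [← ht]
      refine sum_le_sum fun l _ => mul_le_mul_of_nonneg_left ?_ (hν l)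
      exact max_le_max le_rfl (by linarith [le_max_right (f i) t])
    rcases le_or_gt s (a i) with h | h
    · nlinarith
    · have : s = t := by
        rcases max_choice (f i) t with h' | h'
        · linarith [ha i hi]
        · exact h'
      rw [this, ht] at hcv
      rw [this]
      linarith
  have hab' : ∑ l, ν l * max 0 (f l - a i) ^ 2 ≤ ∑ l, ν l * b i l ^ 2 := by
    refine sum_le_sum fun l _ => ?_
    rcases eq_or_ne (p l) 0 with hl | hl
    · simp [hνdef, hl]
    · refine mul_le_mul_of_nonneg_left (pow_le_pow_left₀ (le_max_left _ _) ?_ 2) (hν l)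
      exact max_le (hb i l hi hl) (by linarith [hab i l hi hl])
  nlinarith [mul_le_mul_of_nonneg_left hmain (hp i), mul_le_mul_of_nonneg_left hab' (hp i)]

/-- Convexity of `(F, F') ↦ F (log (F / F'))₊²`, in integrated form. -/
theorem mul_pos_part_log_sub_log_sq_le {ι : Type*} [Fintype ι] {p F F' : ι → ℝ}
    (hp : ∀ i, 0 ≤ p i) (hF : ∀ i, 0 < F i) (hF' : ∀ i, 0 < F' i)
    (hA : 0 < ∑ i, p i * F i) (hB : 0 < ∑ i, p i * F' i) :
    (∑ i, p i * F i) * max 0 (Real.log (∑ i, p i * F i) - Real.log (∑ i, p i * F' i)) ^ 2 ≤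
      ∑ i, p i * (F i * max 0 (Real.log (F i) - Real.log (F' i)) ^ 2) := by
  set A := ∑ i, p i * F i
  set B := ∑ i, p i * F' i
  set L := max 0 (Real.log A - Real.log B) with hL
  have hL0 : 0 ≤ L := le_max_left _ _
  have htan : ∀ x y : ℝ, 0 < x → 0 < y → (L ^ 2 + 2 * L) * x - 2 * L * Real.exp L * y ≤
      x * max 0 (Real.log x - Real.log y) ^ 2 := by
    intro x y hx hy
    set θ := Real.log x - Real.log y with hθ
    have h1 : 2 * L * θ - L ^ 2 ≤ max 0 θ ^ 2 := by
      nlinarith [sq_nonneg (max 0 θ - L), le_max_right 0 θ]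
    have h2 : Real.exp L * y = x * Real.exp (L - θ) := by
      rw [hθ, Real.exp_sub, Real.exp_sub, Real.exp_log hx, Real.exp_log hy]
      field_simp
    have h3 := Real.add_one_le_exp (L - θ)
    have h4 := mul_le_mul_of_nonneg_left h3 (mul_nonneg (mul_nonneg zero_le_two hL0) hx.le)
    have h5 := mul_le_mul_of_nonneg_left h1 hx.le
    have h6 : 2 * L * Real.exp L * y = 2 * L * x * Real.exp (L - θ) := by
      rw [mul_assoc, h2]; ring
    rw [h6]
    nlinarith
  have hsum : (L ^ 2 + 2 * L) * A - 2 * L * Real.exp L * B ≤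
      ∑ i, p i * (F i * max 0 (Real.log (F i) - Real.log (F' i)) ^ 2) := by
    rw [mul_sum, mul_sum, ← sum_sub_distrib]
    refine sum_le_sum fun i _ => ?_
    have := mul_le_mul_of_nonneg_left (htan _ _ (hF i) (hF' i)) (hp i)
    linarith
  refine le_trans ?_ hsum
  rcases le_or_gt (Real.log A - Real.log B) 0 with h | h
  · have : L = 0 := max_eq_left h
    simp [this]
  · have : L = Real.log A - Real.log B := max_eq_right h.le
    have : Real.exp L * B = A := by
      rw [this, Real.exp_sub, Real.exp_log hA, Real.exp_log hB, div_mul_cancel₀ _ hB.ne']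
    rw [mul_assoc (2 * L), this]
    linarith

end

section
open Finset Equiv

variable {n ℓ : ℕ} {G G' : Subgroup (Perm (Fin n))}

theorem unif_nonneg (G : Subgroup (Perm (Fin n))) (σ : Perm (Fin n)) : 0 ≤ unif G σ := by
  unfold unif; split_ifs <;> positivity

theorem unif_eq_zero {σ : Perm (Fin n)} (h : σ ∉ G) : unif G σ = 0 := if_neg h

theorem mem_of_unif_ne_zero {σ : Perm (Fin n)} (h : unif G σ ≠ 0) : σ ∈ G := by
  by_contra h'; exact h (unif_eq_zero h')

theorem unif_mul_left {g : Perm (Fin n)} (hg : g ∈ G) (σ : Perm (Fin n)) :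
    unif G (g * σ) = unif G σ := by
  simp only [unif, G.mul_mem_cancel_left hg]

theorem unif_mul_right {g : Perm (Fin n)} (hg : g ∈ G) (σ : Perm (Fin n)) :
    unif G (σ * g) = unif G σ := by
  simp only [unif, G.mul_mem_cancel_right hg]

theorem sum_unif (G : Subgroup (Perm (Fin n))) : ∑ σ, unif G σ = 1 := by
  have h : (Nat.card G : ℝ) ≠ 0 := Nat.cast_ne_zero.2 Nat.card_pos.ne'
  have h' : #{σ | σ ∈ G} = Nat.card G := by
    rw [Nat.card_eq_fintype_card, Fintype.card_subtype]
  simp only [unif, ← sum_filter, sum_const, nsmul_eq_mul, h', mul_inv_cancel₀ h]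

/-- The mean of a function under the uniform probability measure on `G`. -/
def gmean (G : Subgroup (Perm (Fin n))) (φ : Perm (Fin n) → ℝ) : ℝ := ∑ σ, unif G σ * φ σ

theorem gmean_mono {φ ψ : Perm (Fin n) → ℝ} (h : ∀ σ ∈ G, φ σ ≤ ψ σ) :
    gmean G φ ≤ gmean G ψ := by
  refine sum_le_sum fun σ _ => ?_
  by_cases hσ : σ ∈ G
  · exact mul_le_mul_of_nonneg_left (h σ hσ) (unif_nonneg G σ)
  · simp [unif_eq_zero hσ]

theorem gmean_congr {φ ψ : Perm (Fin n) → ℝ} (h : ∀ σ ∈ G, φ σ = ψ σ) : gmean G φ = gmean G ψ :=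
  le_antisymm (gmean_mono fun σ hσ => (h σ hσ).le) (gmean_mono fun σ hσ => (h σ hσ).ge)

theorem gmean_const (G : Subgroup (Perm (Fin n))) (c : ℝ) : gmean G (fun _ => c) = c := by
  simp only [gmean, ← sum_mul, sum_unif, one_mul]

theorem gmean_add (φ ψ : Perm (Fin n) → ℝ) :
    gmean G (fun σ => φ σ + ψ σ) = gmean G φ + gmean G ψ := by
  simp only [gmean, mul_add, sum_add_distrib]

theorem gmean_sub (φ ψ : Perm (Fin n) → ℝ) :
    gmean G (fun σ => φ σ - ψ σ) = gmean G φ - gmean G ψ := by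
  simp only [gmean, mul_sub, sum_sub_distrib]

theorem gmean_const_mul (c : ℝ) (φ : Perm (Fin n) → ℝ) :
    gmean G (fun σ => c * φ σ) = c * gmean G φ := by
  simp only [gmean, mul_sum]; exact sum_congr rfl fun σ _ => by ring

theorem gmean_mul_const (c : ℝ) (φ : Perm (Fin n) → ℝ) :
    gmean G (fun σ => φ σ * c) = gmean G φ * c := by
  simp only [gmean, sum_mul]; exact sum_congr rfl fun σ _ => by ring

theorem gmean_sum {κ : Type*} (s : Finset κ) (φ : κ → Perm (Fin n) → ℝ) :
    gmean G (fun σ => ∑ k ∈ s, φ k σ) = ∑ k ∈ s, gmean G (φ k) := by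
  simp only [gmean, mul_sum]; exact sum_comm

theorem gmean_comm (φ : Perm (Fin n) → Perm (Fin n) → ℝ) :
    gmean G (fun σ => gmean G' (fun τ => φ σ τ)) =
      gmean G' (fun τ => gmean G (fun σ => φ σ τ)) := by
  simp only [gmean, mul_sum]
  rw [sum_comm]
  exact sum_congr rfl fun σ _ => sum_congr rfl fun τ _ => by ring

theorem gmean_nonneg {φ : Perm (Fin n) → ℝ} (h : ∀ σ ∈ G, 0 ≤ φ σ) : 0 ≤ gmean G φ := by
  simpa only [gmean_const] using gmean_mono (φ := fun _ => 0) h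

theorem gmean_mul_left {g : Perm (Fin n)} (hg : g ∈ G) (φ : Perm (Fin n) → ℝ) :
    gmean G (fun σ => φ (g * σ)) = gmean G φ := by
  unfold gmean
  rw [← Equiv.sum_comp (Equiv.mulLeft g) (fun σ => unif G σ * φ σ)]
  exact sum_congr rfl fun σ _ => by simp [unif_mul_left hg]

theorem gmean_mul_right {g : Perm (Fin n)} (hg : g ∈ G) (φ : Perm (Fin n) → ℝ) :
    gmean G (fun σ => φ (σ * g)) = gmean G φ := by
  unfold gmean
  rw [← Equiv.sum_comp (Equiv.mulRight g) (fun σ => unif G σ * φ σ)]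
  exact sum_congr rfl fun σ _ => by simp [unif_mul_right hg]

theorem gmean_tower (h : G' ≤ G) (φ : Perm (Fin n) → ℝ) :
    gmean G (fun x => gmean G' (fun y => φ (x * y))) = gmean G φ := by
  rw [gmean_comm, ← gmean_const G' (gmean G φ)]
  exact gmean_congr fun y hy => gmean_mul_right (h hy) φ

theorem gmean_pos {φ : Perm (Fin n) → ℝ} (h : ∀ σ, 0 < φ σ) : 0 < gmean G φ := by
  refine sum_pos' (fun σ _ => mul_nonneg (unif_nonneg G σ) (h σ).le) ⟨1, mem_univ _, ?_⟩
  have : 0 < unif G 1 := by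
    rw [unif, if_pos G.one_mem, inv_pos]; exact_mod_cast Nat.card_pos
  exact mul_pos this (h 1)

theorem partitionFn_unif (f : Perm (Fin n) → ℝ) :
    partitionFn (unif G) f 1 = gmean G (fun σ => Real.exp (f σ)) := by
  simp [partitionFn, gmean]

/-- The subgroup of `G` fixing `j`. -/
def stab (G : Subgroup (Perm (Fin n))) (j : Fin n) : Subgroup (Perm (Fin n)) :=
  G ⊓ MulAction.stabilizer (Perm (Fin n)) j

theorem mem_stab {j : Fin n} {σ : Perm (Fin n)} : σ ∈ stab G j ↔ σ ∈ G ∧ σ j = j := by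
  simp [stab, Subgroup.mem_inf, MulAction.mem_stabilizer_iff]

theorem stab_le (G : Subgroup (Perm (Fin n))) (j : Fin n) : stab G j ≤ G := inf_le_left

theorem IsLLocal.pointStab (hG : IsLLocal ℓ G) (j : Fin n) : IsLLocal ℓ (stab G j) := by
  intro σ hσ i k hik
  obtain ⟨τ, hτ, hs, hd, hτi⟩ := hG σ (mem_stab.1 hσ).1 i k hik
  refine ⟨τ, mem_stab.2 ⟨hτ, ?_⟩, hs, hd, hτi⟩
  by_contra h
  exact hs h (mem_stab.1 hσ).2

/-- `G` fixes every point outside `S`. -/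
def FixesOutside (G : Subgroup (Perm (Fin n))) (S : Finset (Fin n)) : Prop :=
  ∀ σ ∈ G, ∀ k ∉ S, σ k = k

theorem FixesOutside.pointStab {S : Finset (Fin n)} (h : FixesOutside G S) (j : Fin n) :
    FixesOutside (stab G j) (S.erase j) := by
  intro σ hσ k hk
  by_cases hkj : k = j
  · rw [hkj]; exact (mem_stab.1 hσ).2
  · exact h σ (mem_stab.1 hσ).1 k fun hkS => hk (mem_erase.2 ⟨hkj, hkS⟩)

theorem FixesOutside.eq_one (h : FixesOutside G ∅) {σ : Perm (Fin n)} (hσ : σ ∈ G) : σ = 1 :=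
  Equiv.ext fun k => h σ hσ k (notMem_empty k)

theorem degree_conj (σ τ : Perm (Fin n)) : degree (σ⁻¹ * τ * σ) = degree τ := by
  unfold degree
  refine card_bij (fun i _ => σ i) (fun i hi => ?_) (fun i _ j _ h => σ.injective h)
    (fun j hj => ⟨σ⁻¹ j, ?_, σ.apply_symm_apply j⟩)
  · simp only [mem_filter, mem_univ, true_and] at hi ⊢
    intro h
    refine hi ?_
    change σ⁻¹ (τ (σ i)) = i
    rw [h]
    exact σ.symm_apply_apply i
  · simp only [mem_filter, mem_univ, true_and] at hj ⊢
    intro h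
    have h' : τ (σ (σ⁻¹ j)) = σ (σ⁻¹ j) := σ⁻¹.injective (h.trans (σ.symm_apply_apply _).symm)
    rw [show σ (σ⁻¹ j) = j from σ.apply_symm_apply j] at h'
    exact hj h'

/-- A choice, for each pair of points, of an element of degree at most `ℓ` moving the first to the
second. -/
theorem IsLLocal.exists_table (hG : IsLLocal ℓ G) : ∃ T : Fin n → Fin n → Perm (Fin n),
    ∀ σ ∈ G, ∀ i, T i (σ i) ∈ G ∧ degree (T i (σ i)) ≤ ℓ ∧ T i (σ i) i = σ i := by
  have : ∀ i k : Fin n, ∃ τ : Perm (Fin n), ∀ σ ∈ G, σ i = k → τ ∈ G ∧ degree τ ≤ ℓ ∧ τ i = k := by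
    intro i k
    by_cases h : ∃ σ ∈ G, σ i = k
    · obtain ⟨σ, hσ, hik⟩ := h
      obtain ⟨τ, hτ, -, hd, h⟩ := hG σ hσ i k hik
      exact ⟨τ, fun _ _ _ => ⟨hτ, hd, h⟩⟩
    · exact ⟨1, fun σ hσ hik => absurd ⟨σ, hσ, hik⟩ h⟩
  choose T hT using this
  exact ⟨T, fun σ hσ i => hT i (σ i) σ hσ rfl⟩

theorem gmean_coset_eq {j : Fin n} {x y : Perm (Fin n)} (hx : x ∈ G) (hy : y ∈ G)
    (h : x j = y j) (φ : Perm (Fin n) → ℝ) :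
    gmean (stab G j) (fun τ => φ (x * τ)) = gmean (stab G j) (fun τ => φ (y * τ)) := by
  have hm : y⁻¹ * x ∈ stab G j :=
    mem_stab.2 ⟨G.mul_mem (G.inv_mem hy) hx, by simp [Perm.mul_apply, h]⟩
  rw [← gmean_mul_left hm (fun τ => φ (y * τ))]
  simp only [mul_assoc, mul_inv_cancel_left]

/-- Entropy of `exp f` under the uniform measure on `G`. -/
def expEntropy (G : Subgroup (Perm (Fin n))) (f : Perm (Fin n) → ℝ) : ℝ :=
  gmean G (fun x => Real.exp (f x) * f x) -
    gmean G (fun x => Real.exp (f x)) * Real.log (gmean G fun x => Real.exp (f x))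

/-- Squared decreases of `f` along right multiplication by `t`, weighted by `exp f`. -/
def decrease (G : Subgroup (Perm (Fin n))) (f : Perm (Fin n) → ℝ) (t : Perm (Fin n)) : ℝ :=
  gmean G (fun x => Real.exp (f x) * max 0 (f x - f (x * t)) ^ 2)

theorem expEntropy_le (G : Subgroup (Perm (Fin n))) (f : Perm (Fin n) → ℝ) :
    expEntropy G f ≤ 1 / 2 * gmean G (fun y => gmean G (fun x =>
      Real.exp (f x) * max 0 (f x - f y) ^ 2)) := by
  have := entropy_le_upwardEnergy (unif_nonneg G) (sum_unif G) f
  simpa only [expEntropy, gmean, ← partitionFn_unif, ← mul_assoc, partitionFn, one_mul] using this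

theorem expEntropy_tower (h : G' ≤ G) (f : Perm (Fin n) → ℝ) :
    expEntropy G f = gmean G (fun x => expEntropy G' (fun y => f (x * y))) +
      expEntropy G (fun x => Real.log (gmean G' fun y => Real.exp (f (x * y)))) := by
  have hA : ∀ x, 0 < gmean G' fun y => Real.exp (f (x * y)) := fun x =>
    gmean_pos fun y => Real.exp_pos _
  simp only [expEntropy, Real.exp_log (hA _)]
  rw [gmean_sub, gmean_tower h (fun x => Real.exp (f x) * f x),
    gmean_tower h (fun x => Real.exp (f x))]
  ring

theorem expEntropy_log_le (hG : IsLLocal ℓ G) (j : Fin n) :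
    ∃ T : Perm (Fin n) → Perm (Fin n) → Perm (Fin n),
      (∀ v ∈ G, ∀ z ∈ G, T v z ∈ G ∧ degree (T v z) ≤ ℓ) ∧
      ∀ f : Perm (Fin n) → ℝ,
        expEntropy G (fun x => Real.log (gmean (stab G j) fun y => Real.exp (f (x * y)))) ≤
        1 / 2 * gmean G (fun v => gmean G (fun z => decrease G f (T v z))) := by
  obtain ⟨T, hT⟩ := hG.exists_table
  have hT' : ∀ v ∈ G, ∀ z ∈ G, T (v j) (z j) ∈ G ∧ degree (T (v j) (z j)) ≤ ℓ ∧
      T (v j) (z j) (v j) = z j := by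
    intro v hv z hz
    simpa using hT (z * v⁻¹) (G.mul_mem hz (G.inv_mem hv)) (v j)
  refine ⟨fun v z => v⁻¹ * T (v j) (z j) * v, fun v hv z hz => ⟨?_, ?_⟩, fun f => ?_⟩
  · exact G.mul_mem (G.mul_mem (G.inv_mem hv) (hT' v hv z hz).1) hv
  · rw [degree_conj]; exact (hT' v hv z hz).2.1
  refine (expEntropy_le G _).trans (mul_le_mul_of_nonneg_left ?_ (by norm_num))
  have hA : ∀ x, 0 < gmean (stab G j) fun y => Real.exp (f (x * y)) := fun x =>
    gmean_pos fun y => Real.exp_pos _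
  simp only [Real.exp_log (hA _)]
  set Ψ : Perm (Fin n) → Perm (Fin n) → Perm (Fin n) → ℝ := fun u x y => Real.exp (f x) *
    max 0 (f x - f (u⁻¹ * T (u (x j)) (u (y j)) * u * x)) ^ 2 with hΨ
  have key : ∀ u ∈ G, gmean G (fun y => gmean G (fun x => (gmean (stab G j)
      fun h => Real.exp (f (x * h))) * max 0 (Real.log (gmean (stab G j)
      fun h => Real.exp (f (x * h))) - Real.log (gmean (stab G j)
      fun h => Real.exp (f (y * h)))) ^ 2)) ≤ gmean G (fun y => gmean G (fun x => Ψ u x y)) := by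
    intro u hu
    refine gmean_mono fun y hy => ?_
    rw [← gmean_tower (stab_le G j) (fun x => Ψ u x y)]
    refine gmean_mono fun x hx => ?_
    obtain ⟨h1, -, h3⟩ := hT' (u * x) (G.mul_mem hu hx) (u * y) (G.mul_mem hu hy)
    set g := u⁻¹ * T (u (x j)) (u (y j)) * u with hg
    have hgG : g ∈ G := G.mul_mem (G.mul_mem (G.inv_mem hu) h1) hu
    have hgj : (g * x) j = y j := by
      simp only [Perm.mul_apply] at h3
      simp only [hg, Perm.mul_apply, h3]
      exact u.symm_apply_apply (y j)
    rw [← gmean_coset_eq (G.mul_mem hgG hx) hy hgj (fun z => Real.exp (f z))]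
    have hB := mul_pos_part_log_sub_log_sq_le (p := unif (stab G j))
      (F := fun h => Real.exp (f (x * h))) (F' := fun h => Real.exp (f (g * x * h)))
      (unif_nonneg _) (fun _ => Real.exp_pos _) (fun _ => Real.exp_pos _) (hA x) (hA (g * x))
    refine hB.trans (le_of_eq (gmean_congr (G := stab G j) fun h hh => ?_))
    have hhj : (x * h) j = x j := by rw [Perm.mul_apply, (mem_stab.1 hh).2]
    simp only [Real.log_exp, hΨ, hhj, hg, mul_assoc]
  calc _ = gmean G (fun _ => _) := (gmean_const G _).symm
    _ ≤ gmean G (fun u => gmean G (fun y => gmean G (fun x => Ψ u x y))) := gmean_mono key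
    _ = gmean G (fun u => gmean G (fun x => gmean G (fun z => Ψ u x (u⁻¹ * z)))) := by
        refine gmean_congr fun u hu => ?_
        rw [gmean_comm]
        exact gmean_congr fun x _ => (gmean_mul_left (G.inv_mem hu) (fun y => Ψ u x y)).symm
    _ = gmean G (fun x => gmean G (fun v => gmean G (fun z =>
          Ψ (v * x⁻¹) x ((v * x⁻¹)⁻¹ * z)))) := by
        rw [gmean_comm]
        refine gmean_congr fun x hx => ?_
        exact (gmean_mul_right (G.inv_mem hx)
          (fun u => gmean G (fun z => Ψ u x (u⁻¹ * z)))).symm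
    _ = gmean G (fun v => gmean G (fun z => gmean G (fun x =>
          Ψ (v * x⁻¹) x ((v * x⁻¹)⁻¹ * z)))) := by
        rw [gmean_comm]
        exact gmean_congr fun v _ => gmean_comm _
    _ = _ := by
        refine gmean_congr fun v _ => gmean_congr fun z _ => gmean_congr fun x _ => ?_
        simp [hΨ, mul_assoc]

/-- Modified logarithmic Sobolev inequality for local groups. -/
theorem IsLLocal.expEntropy_le_sum_decrease (w : Fin n → ℝ) (hw : ∀ k, 0 ≤ w k)
    (S : Finset (Fin n)) : ∀ G : Subgroup (Perm (Fin n)), IsLLocal ℓ G → FixesOutside G S →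
    ∃ κ : Perm (Fin n) → ℝ, (∀ t, 0 ≤ κ t) ∧ (∀ t, κ t ≠ 0 → t ∈ G ∧ degree t ≤ ℓ) ∧
      ∑ t, κ t * (∑ k with t k ≠ k, w k) ≤ ℓ * ∑ k ∈ S, w k ∧
      ∀ f, expEntropy G f ≤ 1 / 2 * ∑ t, κ t * decrease G f t := by
  refine Finset.induction_on_max_value w S (fun G _ hS => ?_) (fun j S hjS hmax ih G hG hS => ?_)
  · refine ⟨fun _ => 0, fun _ => le_rfl, fun t h => absurd rfl h, by simp, fun f => ?_⟩
    have h : ∀ φ : Perm (Fin n) → ℝ, gmean G φ = φ 1 := fun φ =>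
      (gmean_congr fun σ hσ => by rw [hS.eq_one hσ]).trans (gmean_const G (φ 1))
    simp [expEntropy, h]
  have hS' : FixesOutside (stab G j) S := by
    simpa [erase_insert hjS] using hS.pointStab j
  obtain ⟨κ', h0, hsupp, hwt, hent⟩ := ih (stab G j) (hG.pointStab j) hS'
  obtain ⟨T, hT, hTent⟩ := expEntropy_log_le hG j
  set κb : Perm (Fin n) → ℝ := fun t => gmean G fun v => gmean G fun z => if T v z = t then 1 else 0
    with hκb
  have hκb0 : ∀ t, 0 ≤ κb t := fun t => gmean_nonneg fun v _ => gmean_nonneg fun z _ => by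
    split_ifs <;> norm_num
  have hκbsum : ∀ φ : Perm (Fin n) → ℝ,
      ∑ t, κb t * φ t = gmean G fun v => gmean G fun z => φ (T v z) := by
    intro φ
    simp only [hκb, ← gmean_mul_const, ← gmean_sum]
    simp
  refine ⟨fun t => κb t + κ' t, fun t => add_nonneg (hκb0 t) (h0 t), fun t ht => ?_, ?_,
    fun f => ?_⟩
  · by_cases h : κ' t = 0
    · by_contra hcon
      refine ht ?_
      simp only [h, add_zero]
      refine (gmean_congr (ψ := fun _ => 0) fun v hv => ?_).trans (gmean_const G 0)
      refine (gmean_congr (ψ := fun _ => 0) fun z hz => if_neg ?_).trans (gmean_const G 0)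
      rintro rfl
      exact hcon (hT v hv z hz)
    · exact ⟨(mem_stab.1 (hsupp t h).1).1, (hsupp t h).2⟩
  · have hb : ∑ t, κb t * (∑ k with t k ≠ k, w k) ≤ ℓ * w j := by
      rw [hκbsum, ← gmean_const G ((ℓ : ℝ) * w j)]
      refine gmean_mono fun v hv => ?_
      rw [← gmean_const G ((ℓ : ℝ) * w j)]
      refine gmean_mono fun z hz => ?_
      have hle : ∀ k ∈ univ.filter (fun k => T v z k ≠ k), w k ≤ w j := by
        intro k hk
        have hk' : k ∈ insert j S := by
          by_contra h
          exact (mem_filter.1 hk).2 (hS _ (hT v hv z hz).1 k h)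
        rcases mem_insert.1 hk' with rfl | hk'
        · exact le_rfl
        · exact hmax k hk'
      refine (sum_le_card_nsmul _ _ _ hle).trans ?_
      rw [nsmul_eq_mul]
      exact mul_le_mul_of_nonneg_right (Nat.cast_le.2 (hT v hv z hz).2) (hw j)
    simp only [add_mul, sum_add_distrib, sum_insert hjS]
    linarith
  · rw [expEntropy_tower (stab_le G j)]
    have h1 : gmean G (fun x => expEntropy (stab G j) (fun y => f (x * y))) ≤
        1 / 2 * ∑ t, κ' t * decrease G f t := by
      calc _ ≤ gmean G (fun x => 1 / 2 * ∑ t, κ' t * decrease (stab G j) (fun y => f (x * y)) t) :=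
            gmean_mono fun x _ => hent _
        _ = _ := by
            rw [gmean_const_mul, gmean_sum]
            congr 1
            refine sum_congr rfl fun t _ => ?_
            rw [gmean_const_mul]
            congr 1
            refine Eq.trans ?_ (gmean_tower (stab_le G j)
              fun x => Real.exp (f x) * max 0 (f x - f (x * t)) ^ 2)
            simp only [decrease, mul_assoc]
    have h2 := hTent f
    rw [← hκbsum (fun t => decrease G f t)] at h2
    simp only [add_mul, sum_add_distrib]
    linarith

theorem IsLLocal.expEntropy_le (hG : IsLLocal ℓ G) {w : Fin n → ℝ} (hw : ∀ k, 0 ≤ w k)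
    {f : Perm (Fin n) → ℝ}
    (h : ∀ t ∈ G, degree t ≤ ℓ → decrease G f t ≤ ℓ * ∑ k with t k ≠ k, w k) :
    expEntropy G f ≤ 1 / 2 * (ℓ : ℝ) ^ 2 * ∑ k, w k := by
  obtain ⟨κ, h0, hsupp, hwt, hent⟩ := IsLLocal.expEntropy_le_sum_decrease w hw univ G hG
    (fun _ _ k hk => absurd (mem_univ k) hk)
  have h1 : ∑ t, κ t * decrease G f t ≤ ∑ t, κ t * (ℓ * ∑ k with t k ≠ k, w k) := by
    refine sum_le_sum fun t _ => ?_
    by_cases ht : κ t = 0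
    · simp [ht]
    · exact mul_le_mul_of_nonneg_left (h t (hsupp t ht).1 (hsupp t ht).2) (h0 t)
  have h2 : ∑ t, κ t * (ℓ * ∑ k with t k ≠ k, w k) =
      ℓ * ∑ t, κ t * ∑ k with t k ≠ k, w k := by
    rw [mul_sum]; exact sum_congr rfl fun t _ => by ring
  have h3 := mul_le_mul_of_nonneg_left hwt (Nat.cast_nonneg (α := ℝ) ℓ)
  have := hent f
  nlinarith

theorem log_gmean_exp_le_of_expEntropy_le (h : Perm (Fin n) → ℝ) {s₀ : ℝ} (hs₀ : 0 < s₀)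
    (D₁ D₂ : ℝ) (H : ∀ s, 0 < s → s ≤ s₀ → expEntropy G (fun x => s * h x) ≤
      s ^ 2 * (D₁ * gmean G (fun x => Real.exp (s * h x)) +
        D₂ * gmean G (fun x => Real.exp (s * h x) * h x))) :
    Real.log (gmean G fun x => Real.exp (s₀ * h x)) ≤
      s₀ * (gmean G h + D₁ * s₀ + D₂ * Real.log (gmean G fun x => Real.exp (s₀ * h x))) := by
  set Λ : ℝ → ℝ := fun s => Real.log (gmean G fun x => Real.exp (s * h x)) with hΛ
  set Λ' : ℝ → ℝ := fun s => gmean G (fun x => Real.exp (s * h x) * h x) /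
    gmean G (fun x => Real.exp (s * h x)) with hΛ'
  have hZ : ∀ s, 0 < gmean G (fun x => Real.exp (s * h x)) := fun s =>
    gmean_pos fun x => Real.exp_pos _
  have hd : ∀ s, HasDerivAt Λ (Λ' s) s := by
    intro s
    have := hasDerivAt_log_partitionFn (unif_nonneg G) (sum_unif G) h s
    simp only [mul_assoc] at this
    exact this
  have hH : ∀ s, 0 < s → s ≤ s₀ → s * Λ' s - Λ s ≤ s ^ 2 * (D₁ + D₂ * Λ' s) := by
    intro s h0 h1
    have h2 := H s h0 h1
    have h3 : expEntropy G (fun x => s * h x) =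
        gmean G (fun x => Real.exp (s * h x)) * (s * Λ' s - Λ s) := by
      have : gmean G (fun x => Real.exp (s * h x) * (s * h x)) =
          s * gmean G (fun x => Real.exp (s * h x) * h x) := by
        rw [← gmean_const_mul]; exact gmean_congr fun x _ => by ring
      simp only [expEntropy, this, hΛ', hΛ]
      field_simp [(hZ s).ne']
    have h4 : s ^ 2 * (D₁ * gmean G (fun x => Real.exp (s * h x)) +
        D₂ * gmean G (fun x => Real.exp (s * h x) * h x)) =
        gmean G (fun x => Real.exp (s * h x)) * (s ^ 2 * (D₁ + D₂ * Λ' s)) := by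
      simp only [hΛ']
      field_simp [(hZ s).ne']
    rw [h3, h4] at h2
    exact le_of_mul_le_mul_left h2 (hZ s)
  have hanti : ∀ ε, 0 < ε → ε ≤ s₀ →
      Λ s₀ / s₀ - (D₁ * s₀ + D₂ * Λ s₀) ≤ Λ ε / ε - (D₁ * ε + D₂ * Λ ε) := by
    intro ε hε hεs
    refine le_of_hasDerivAt_nonpos hεs (F := fun s => Λ s / s - (D₁ * s + D₂ * Λ s))
      (fun s hs _ => ((hd s).div (hasDerivAt_id s) (hε.trans_le hs).ne').sub
        (((hasDerivAt_id s).const_mul D₁).add ((hd s).const_mul D₂))) (fun s hs hs' => ?_)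
    have hs0 : 0 < s := hε.trans_le hs
    have := hH s hs0 hs'
    simp only [id, mul_one]
    rw [sub_nonpos, div_le_iff₀ (pow_pos hs0 2)]
    linarith
  have hΛ0 : Λ 0 = 0 := by simp [hΛ, gmean_const]
  have hΛ'0 : Λ' 0 = gmean G h := by simp [hΛ', gmean_const]
  have hlim : Filter.Tendsto (fun ε => Λ ε / ε - (D₁ * ε + D₂ * Λ ε)) (nhdsWithin 0 (Set.Ioi 0))
      (nhds (Λ' 0 - (D₁ * 0 + D₂ * Λ 0))) := by
    refine Filter.Tendsto.sub ?_ ?_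
    · have := (hd 0).tendsto_slope_zero_right
      simp only [zero_add, hΛ0, sub_zero, smul_eq_mul] at this
      exact this.congr fun t => by rw [div_eq_inv_mul]
    · refine Filter.Tendsto.mono_left ?_ nhdsWithin_le_nhds
      exact ((continuous_const.mul continuous_id).continuousAt.add
        (continuousAt_const.mul (hd 0).continuousAt))
  have hfin := ge_of_tendsto hlim (Filter.mem_of_superset
    (Ioc_mem_nhdsGT hs₀) fun ε hε => hanti ε hε.1 hε.2)
  rw [hΛ'0, hΛ0] at hfin
  have : Λ s₀ / s₀ ≤ gmean G h + D₁ * s₀ + D₂ * Λ s₀ := by linarith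
  rw [div_le_iff₀ hs₀] at this
  linarith

theorem sum_unif_ge_le (g : Perm (Fin n) → ℝ) {s : ℝ} (hs : 0 ≤ s) (r : ℝ) :
    ∑ σ ∈ univ.filter (fun σ => r ≤ g σ), unif G σ ≤
      Real.exp (Real.log (gmean G fun x => Real.exp (s * g x)) - s * r) := by
  rw [Real.exp_sub, Real.exp_log (gmean_pos fun x => Real.exp_pos _),
    le_div_iff₀ (Real.exp_pos _), sum_mul]
  refine (sum_le_sum fun σ hσ => mul_le_mul_of_nonneg_left (Real.exp_le_exp.2
    (mul_le_mul_of_nonneg_left (mem_filter.1 hσ).2 hs)) (unif_nonneg G σ)).trans ?_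
  exact sum_le_sum_of_subset_of_nonneg (filter_subset _ _) fun σ _ _ =>
    mul_nonneg (unif_nonneg G σ) (Real.exp_pos _).le

theorem expEntropy_mul_le (hG : IsLLocal ℓ G) (g : Perm (Fin n) → ℝ)
    (a : Fin n → Perm (Fin n) → ℝ)
    (hconf : ∀ σ ∈ G, ∀ τ ∈ G,
      g τ - g σ ≤ ∑ k : Fin n, a k τ * (if τ k ≠ σ k then (1 : ℝ) else 0))
    {s : ℝ} (hs : 0 ≤ s) :
    expEntropy G (fun x => s * g x) ≤ 1 / 2 * (ℓ : ℝ) ^ 2 *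
      (s ^ 2 * gmean G fun x => Real.exp (s * g x) * ∑ k, a k x ^ 2) := by
  have hsum : ∀ T : Finset (Fin n),
      ∑ k ∈ T, s ^ 2 * gmean G (fun x => Real.exp (s * g x) * a k x ^ 2) =
      s ^ 2 * gmean G fun x => Real.exp (s * g x) * ∑ k ∈ T, a k x ^ 2 := by
    intro T
    simp only [mul_sum]
    rw [gmean_sum, mul_sum]
  rw [← hsum univ]
  refine hG.expEntropy_le (fun k => mul_nonneg (sq_nonneg s) (gmean_nonneg fun x _ =>
    mul_nonneg (Real.exp_pos _).le (sq_nonneg _))) fun t ht hdeg => ?_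
  rw [hsum, decrease, ← gmean_const_mul, ← gmean_const_mul]
  refine gmean_mono fun x hx => ?_
  have h1 : g x - g (x * t) ≤ ∑ k with t k ≠ k, a k x := by
    refine (hconf (x * t) (G.mul_mem hx ht) x hx).trans (le_of_eq ?_)
    rw [sum_filter]
    refine sum_congr rfl fun k _ => ?_
    have : (x k ≠ (x * t) k) = (t k ≠ k) := by
      rw [Perm.mul_apply, ne_eq, x.injective.eq_iff, ne_comm]
    simp only [this, mul_ite, mul_one, mul_zero]
  have h2 : max 0 (s * g x - s * g (x * t)) ^ 2 ≤ s ^ 2 * (ℓ * ∑ k with t k ≠ k, a k x ^ 2) := by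
    have h3 : (∑ k with t k ≠ k, a k x) ^ 2 ≤ ℓ * ∑ k with t k ≠ k, a k x ^ 2 :=
      sq_sum_le_card_mul_sum_sq.trans (mul_le_mul_of_nonneg_right (Nat.cast_le.2 hdeg)
        (sum_nonneg fun _ _ => sq_nonneg _))
    have h4 : 0 ≤ s ^ 2 * (ℓ * ∑ k with t k ≠ k, a k x ^ 2) := by positivity
    rcases le_total (s * g x - s * g (x * t)) 0 with h | h
    · rw [max_eq_left h]; simpa using h4
    · rw [max_eq_right h]
      have h5 : s * g x - s * g (x * t) ≤ s * ∑ k with t k ≠ k, a k x := by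
        rw [← mul_sub]; exact mul_le_mul_of_nonneg_left h1 hs
      calc _ ≤ (s * ∑ k with t k ≠ k, a k x) ^ 2 := pow_le_pow_left₀ h h5 2
        _ = s ^ 2 * (∑ k with t k ≠ k, a k x) ^ 2 := by ring
        _ ≤ _ := mul_le_mul_of_nonneg_left h3 (sq_nonneg s)
  have := mul_le_mul_of_nonneg_left h2 (Real.exp_pos (s * g x)).le
  linarith

theorem sum_unif_filter_le_one (P : Perm (Fin n) → Prop) :
    ∑ σ ∈ univ.filter P, unif G σ ≤ 1 := by
  rw [← sum_unif G]
  exact sum_le_sum_of_subset_of_nonneg (filter_subset _ _) fun σ _ _ => unif_nonneg G σ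

theorem upper_tail_le (hG : IsLLocal ℓ G) (g : Perm (Fin n) → ℝ) (a : Fin n → Perm (Fin n) → ℝ)
    (hconf : ∀ σ ∈ G, ∀ τ ∈ G,
      g τ - g σ ≤ ∑ k : Fin n, a k τ * (if τ k ≠ σ k then (1 : ℝ) else 0))
    {c A : ℝ} (hc : (ℓ : ℝ) ^ 2 ≤ c) (hA : ∀ σ ∈ G, ∑ k, a k σ ^ 2 ≤ A) {u : ℝ} (hu : 0 ≤ u) :
    ∑ σ ∈ univ.filter (fun σ => gmean G g + u ≤ g σ), unif G σ ≤
      Real.exp (-(u ^ 2) / (2 * c * A)) := by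
  have hc0 : 0 ≤ c := (sq_nonneg _).trans hc
  have hA0 : 0 ≤ A := (sum_nonneg fun _ _ => sq_nonneg _).trans (hA 1 G.one_mem)
  rcases (mul_nonneg hc0 hA0).eq_or_lt with h | hcA
  · rw [mul_assoc, ← h]; simpa using sum_unif_filter_le_one _
  rcases hu.eq_or_lt with rfl | hu
  · simpa using sum_unif_filter_le_one _
  have hs : 0 < u / (c * A) := div_pos hu hcA
  refine (sum_unif_ge_le g hs.le _).trans (Real.exp_le_exp.2 ?_)
  have hE := log_gmean_exp_le_of_expEntropy_le (G := G) g hs (1 / 2 * (c * A)) 0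
    fun s h0 _ => by
    refine (expEntropy_mul_le hG g a hconf h0.le).trans ?_
    have h1 : gmean G (fun x => Real.exp (s * g x) * ∑ k, a k x ^ 2) ≤
        A * gmean G (fun x => Real.exp (s * g x)) := by
      rw [← gmean_const_mul]
      refine gmean_mono fun x hx => ?_
      rw [mul_comm A]
      exact mul_le_mul_of_nonneg_left (hA x hx) (Real.exp_pos _).le
    have h2 : 0 ≤ A * gmean G (fun x => Real.exp (s * g x)) :=
      mul_nonneg hA0 (gmean_nonneg fun _ _ => (Real.exp_pos _).le)
    have h3 := mul_le_mul_of_nonneg_left h1 (sq_nonneg s)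
    have h4 := mul_le_mul_of_nonneg_right hc (mul_nonneg (sq_nonneg s) h2)
    have h5 := mul_le_mul_of_nonneg_left h3 (sq_nonneg (ℓ : ℝ))
    linarith
  have h6 : -(u ^ 2) / (2 * c * A) = u / (c * A) * (1 / 2 * (c * A) * (u / (c * A)) - u) := by
    have h1 : c ≠ 0 := left_ne_zero_of_mul hcA.ne'
    have h2 : A ≠ 0 := right_ne_zero_of_mul hcA.ne'
    field_simp; ring
  rw [h6]
  linarith

theorem upper_tail_self_bounding_le (hG : IsLLocal ℓ G) (g : Perm (Fin n) → ℝ)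
    (a : Fin n → Perm (Fin n) → ℝ)
    (hconf : ∀ σ ∈ G, ∀ τ ∈ G,
      g τ - g σ ≤ ∑ k : Fin n, a k τ * (if τ k ≠ σ k then (1 : ℝ) else 0))
    {c M : ℝ} (hc : (ℓ : ℝ) ^ 2 ≤ c) (hM : 0 ≤ M)
    (hA : ∀ σ ∈ G, ∑ k, a k σ ^ 2 ≤ M * g σ) {u : ℝ} (hu : 0 ≤ u) :
    ∑ σ ∈ univ.filter (fun σ => gmean G g + u ≤ g σ), unif G σ ≤
      Real.exp (-(u ^ 2) / (2 * c * M * (gmean G g + u))) := by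
  have hc0 : 0 ≤ c := (sq_nonneg _).trans hc
  rcases (mul_nonneg hc0 hM).eq_or_lt with h | hD
  · rw [mul_assoc 2, ← h]; simpa using sum_unif_filter_le_one _
  rcases hu.eq_or_lt with rfl | hu
  · simpa using sum_unif_filter_le_one _
  have hc' : c ≠ 0 := left_ne_zero_of_mul hD.ne'
  have hM' : 0 < M := hM.lt_of_ne (by rintro rfl; simp at hD)
  have hm : 0 ≤ gmean G g := gmean_nonneg fun σ hσ => nonneg_of_mul_nonneg_right
    ((sum_nonneg fun _ _ => sq_nonneg _).trans (hA σ hσ)) hM'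
  set m := gmean G g with hmdef
  have ht : 0 < m + u := by linarith
  have hs : 0 < u / (c * M * (m + u)) := by positivity
  refine (sum_unif_ge_le g hs.le _).trans (Real.exp_le_exp.2 ?_)
  have hE := log_gmean_exp_le_of_expEntropy_le (G := G) g hs 0 (1 / 2 * (c * M))
    fun s h0 _ => by
    refine (expEntropy_mul_le hG g a hconf h0.le).trans ?_
    have h1 : gmean G (fun x => Real.exp (s * g x) * ∑ k, a k x ^ 2) ≤
        M * gmean G (fun x => Real.exp (s * g x) * g x) := by
      rw [← gmean_const_mul]
      refine gmean_mono fun x hx => ?_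
      have := mul_le_mul_of_nonneg_left (hA x hx) (Real.exp_pos (s * g x)).le
      linarith
    have h2 : 0 ≤ M * gmean G (fun x => Real.exp (s * g x) * g x) :=
      (gmean_nonneg fun _ _ => mul_nonneg (Real.exp_pos _).le
        (sum_nonneg fun _ _ => sq_nonneg _)).trans h1
    have h3 := mul_le_mul_of_nonneg_left h1 (sq_nonneg s)
    have h4 := mul_le_mul_of_nonneg_right hc (mul_nonneg (sq_nonneg s) h2)
    have h5 := mul_le_mul_of_nonneg_left h3 (sq_nonneg (ℓ : ℝ))
    linarith
  rw [← hmdef] at hE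
  set L := Real.log (gmean G fun x => Real.exp (u / (c * M * (m + u)) * g x))
  have hL : L * (2 * m + u) ≤ 2 * m * u / (c * M) := by
    have e : u / (c * M * (m + u)) * (m + 0 * (u / (c * M * (m + u))) + 1 / 2 * (c * M) * L) =
        (2 * m * u / (c * M) + u * L) / (2 * (m + u)) := by
      field_simp; ring
    rw [e, le_div_iff₀ (by linarith)] at hE
    linarith
  have hL' : L ≤ 2 * m * u / (c * M) / (2 * m + u) := by rwa [le_div_iff₀ (by linarith)]
  have e1 : 2 * m * u / (c * M) / (2 * m + u) - u / (c * M * (m + u)) * (m + u) =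
      -(u ^ 2) / (c * M * (2 * m + u)) := by
    have : 2 * m + u ≠ 0 := by linarith
    field_simp; ring
  refine (sub_le_sub_right hL' _).trans (e1.le.trans ?_)
  rw [neg_div, neg_div, neg_le_neg_iff]
  refine div_le_div_of_nonneg_left (sq_nonneg u) (by positivity) ?_
  nlinarith

/-- The smallest `β`-weighted Hamming distance from `x` to an element of `A`. -/
def hammingDistTo (A : Finset (Perm (Fin n))) (hA : A.Nonempty) (x : Perm (Fin n))
    (β : Fin n → ℝ) : ℝ :=
  A.inf' hA fun z => ∑ k, β k * if x k ≠ z k then (1 : ℝ) else 0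

variable {A : Finset (Perm (Fin n))} {hA : A.Nonempty}

theorem continuous_hammingDistTo (x : Perm (Fin n)) : Continuous (hammingDistTo A hA x) := by
  unfold hammingDistTo
  exact Continuous.finset_inf'_apply hA fun z _ => by fun_prop

theorem hammingDistTo_le {z : Perm (Fin n)} (hz : z ∈ A) (x : Perm (Fin n)) (β : Fin n → ℝ) :
    hammingDistTo A hA x β ≤ ∑ k, β k * if x k ≠ z k then (1 : ℝ) else 0 :=
  inf'_le _ hz

theorem hammingDistTo_nonneg (x : Perm (Fin n)) {β : Fin n → ℝ} (hβ : ∀ k, 0 ≤ β k) :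
    0 ≤ hammingDistTo A hA x β :=
  le_inf' _ _ fun z _ => sum_nonneg fun k _ => mul_nonneg (hβ k) (by split_ifs <;> norm_num)

theorem hammingDistTo_smul (x : Perm (Fin n)) (β : Fin n → ℝ) {c : ℝ} (hc : 0 ≤ c) :
    c * hammingDistTo A hA x β ≤ hammingDistTo A hA x fun k => c * β k := by
  refine le_inf' _ _ fun z hz => ?_
  refine (mul_le_mul_of_nonneg_left (hammingDistTo_le hz x β) hc).trans (le_of_eq ?_)
  rw [mul_sum]
  exact sum_congr rfl fun k _ => by ring

theorem hammingDistTo_le_add (x y : Perm (Fin n)) (T : Finset (Fin n))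
    (h : ∀ k ∉ T, x k = y k) {β : Fin n → ℝ} (hβ : ∀ k, 0 ≤ β k) :
    hammingDistTo A hA x β ≤
      hammingDistTo A hA y (fun k => if k ∈ T then 0 else β k) + ∑ k ∈ T, β k := by
  rw [← sub_le_iff_le_add]
  refine le_inf' _ _ fun z hz => ?_
  have hT : ∑ k ∈ T, β k = ∑ k, if k ∈ T then β k else 0 := by rw [sum_ite_mem, univ_inter]
  rw [sub_le_iff_le_add, hT, ← sum_add_distrib]
  refine (hammingDistTo_le hz x β).trans (sum_le_sum fun k _ => ?_)
  by_cases hk : k ∈ T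
  · simp only [hk, if_true, zero_mul, zero_add]
    exact mul_le_of_le_one_right (hβ k) (by split_ifs <;> norm_num)
  · simp [hk, h k hk]

theorem hammingDistTo_min_one (x : Perm (Fin n)) (β : Fin n → ℝ) :
    2 * hammingDistTo A hA x β - ∑ k, β k ^ 2 ≤
      2 * hammingDistTo A hA x (fun k => min (β k) 1) - ∑ k, min (β k) 1 ^ 2 := by
  have h1 : hammingDistTo A hA x β - ∑ k, (β k - min (β k) 1) ≤
      hammingDistTo A hA x (fun k => min (β k) 1) := by
    refine le_inf' _ _ fun z hz => ?_
    rw [sub_le_iff_le_add, ← sum_add_distrib]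
    refine (hammingDistTo_le hz x β).trans (sum_le_sum fun k _ => ?_)
    have := min_le_left (β k) 1
    split_ifs <;> linarith
  have h2 : 2 * ∑ k, (β k - min (β k) 1) ≤ ∑ k, β k ^ 2 - ∑ k, min (β k) 1 ^ 2 := by
    rw [mul_sum, ← sum_sub_distrib]
    refine sum_le_sum fun k _ => ?_
    rcases min_cases (β k) 1 with ⟨h, _⟩ | ⟨h, _⟩ <;> rw [h] <;> nlinarith
  linarith

theorem exists_convex_distance (A : Finset (Perm (Fin n))) (hA : A.Nonempty) :
    ∃ (φ : Perm (Fin n) → ℝ) (β : Perm (Fin n) → Fin n → ℝ),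
      (∀ x k, 0 ≤ β x k ∧ β x k ≤ 1) ∧ (∀ x, 0 ≤ φ x) ∧ (∀ x ∈ A, φ x ≤ 0) ∧
      (∀ x, ∑ k, β x k ^ 2 ≤ φ x) ∧
      (∀ x y, ∀ T : Finset (Fin n), (∀ k ∉ T, x k = y k) →
        φ x - φ y ≤ ∑ k ∈ T, (2 * β x k - β x k ^ 2)) ∧
      ∀ x, ∀ α : Fin n → ℝ, (∀ k, 0 ≤ α k) →
        hammingDistTo A hA x α ≤ √(∑ k, α k ^ 2) * √(φ x) := by
  have hex : ∀ x, ∃ β : Fin n → ℝ, (∀ k, 0 ≤ β k ∧ β k ≤ 1) ∧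
      ∀ β' : Fin n → ℝ, (∀ k, 0 ≤ β' k ∧ β' k ≤ 1) →
        2 * hammingDistTo A hA x β' - ∑ k, β' k ^ 2 ≤
          2 * hammingDistTo A hA x β - ∑ k, β k ^ 2 := by
    intro x
    have hc : Continuous fun β : Fin n → ℝ => 2 * hammingDistTo A hA x β - ∑ k, β k ^ 2 :=
      (continuous_const.mul (continuous_hammingDistTo x)).sub (by fun_prop)
    obtain ⟨β, hβ, hmax⟩ := (isCompact_Icc (a := (0 : Fin n → ℝ)) (b := 1)).exists_isMaxOn
      ⟨0, Set.left_mem_Icc.2 zero_le_one⟩ hc.continuousOn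
    exact ⟨β, fun k => ⟨hβ.1 k, hβ.2 k⟩, fun β' h => hmax ⟨fun k => (h k).1, fun k => (h k).2⟩⟩
  choose β hβ hmax using hex
  have hsq : ∀ x, 0 ≤ ∑ k, β x k ^ 2 := fun x => sum_nonneg fun _ _ => sq_nonneg _
  have hφ0 : ∀ x, 0 ≤ 2 * hammingDistTo A hA x (β x) - ∑ k, β x k ^ 2 := by
    intro x
    refine le_trans ?_ (hmax x 0 (by simp))
    have := hammingDistTo_nonneg (A := A) (hA := hA) x (β := 0) (by simp)
    simp [this]
  refine ⟨fun x => 2 * hammingDistTo A hA x (β x) - ∑ k, β x k ^ 2, β, hβ, hφ0,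
    fun x hx => ?_, fun x => ?_, fun x y T hT => ?_, fun x α hα => ?_⟩
  · have := hammingDistTo_le (hA := hA) hx x (β x)
    simp only [ne_eq, not_true_eq_false, if_false, mul_zero, sum_const_zero] at this
    linarith [hsq x]
  · set D := hammingDistTo A hA x (β x) with hD
    set q := ∑ k, β x k ^ 2 with hq
    have hD0 : 0 ≤ D := hammingDistTo_nonneg x fun k => (hβ x k).1
    change q ≤ 2 * D - q
    by_contra hcon
    have hlt : D < q := by linarith
    have hq0 : 0 < q := hD0.trans_lt hlt
    have hc0 : 0 ≤ D / q := div_nonneg hD0 hq0.le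
    have hc1 : D / q ≤ 1 := (div_le_one hq0).2 hlt.le
    have h1 := hmax x (fun k => D / q * β x k) fun k =>
      ⟨mul_nonneg hc0 (hβ x k).1, mul_le_one₀ hc1 (hβ x k).1 (hβ x k).2⟩
    have h2 := hammingDistTo_smul (A := A) (hA := hA) x (β x) hc0
    simp only [mul_pow, ← mul_sum, ← hD, ← hq] at h1 h2
    have e : (D / q) ^ 2 * q = D / q * D := by field_simp
    have e2 : D / q * q = D := by field_simp
    rw [e] at h1
    nlinarith [mul_pos (sub_pos.2 hlt) (sub_pos.2 hlt)]
  · have h1 := hmax y (fun k => if k ∈ T then 0 else β x k) fun k => by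
      split_ifs
      · simp
      · exact hβ x k
    have h2 := hammingDistTo_le_add (A := A) (hA := hA) x y T hT fun k => (hβ x k).1
    have h3 : ∑ k, (if k ∈ T then 0 else β x k) ^ 2 + ∑ k ∈ T, β x k ^ 2 = ∑ k, β x k ^ 2 := by
      have hT' : ∑ k ∈ T, β x k ^ 2 = ∑ k, if k ∈ T then β x k ^ 2 else 0 := by
        rw [sum_ite_mem, univ_inter]
      rw [hT', ← sum_add_distrib]
      exact sum_congr rfl fun k _ => by split_ifs <;> simp
    simp only [sum_sub_distrib, ← mul_sum]
    linarith
  · set D := hammingDistTo A hA x α with hD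
    set N := ∑ k, α k ^ 2 with hN
    set Φ := 2 * hammingDistTo A hA x (β x) - ∑ k, β x k ^ 2 with hΦ
    have hD0 : 0 ≤ D := hammingDistTo_nonneg x hα
    have hN0 : 0 ≤ N := sum_nonneg fun _ _ => sq_nonneg _
    have hkey : ∀ c, 0 ≤ c → 2 * (c * D) - c ^ 2 * N ≤ Φ := by
      intro c hc
      have h1 := hammingDistTo_min_one (A := A) (hA := hA) x (fun k => c * α k)
      have h2 := hammingDistTo_smul (A := A) (hA := hA) x α hc
      have h3 := hmax x (fun k => min (c * α k) 1) fun k =>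
        ⟨le_min (mul_nonneg hc (hα k)) zero_le_one, min_le_right _ _⟩
      simp only [mul_pow, ← mul_sum] at h1
      linarith
    rw [← Real.sqrt_mul hN0]
    refine Real.le_sqrt_of_sq_le ?_
    rcases hN0.eq_or_lt with h | h
    · have hα0 : ∀ k, α k = 0 := fun k => by
        have := (sum_eq_zero_iff_of_nonneg (fun i _ => sq_nonneg (α i))).1 h.symm k (mem_univ k)
        exact pow_eq_zero_iff two_ne_zero |>.1 this
      obtain ⟨z, hz⟩ := hA
      have := hammingDistTo_le (hA := ⟨z, hz⟩) hz x α
      simp only [hα0, zero_mul, sum_const_zero] at this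
      have : D = 0 := le_antisymm this hD0
      rw [this, ← h]; simp
    · have h1 := hkey (D / N) (div_nonneg hD0 h.le)
      have e : 2 * (D / N * D) - (D / N) ^ 2 * N = D ^ 2 / N := by field_simp; ring
      rw [e, div_le_iff₀ h] at h1
      linarith

theorem exp_mul_sq_le {T : Finset (Fin n)} (hT : #T ≤ ℓ) {b : Fin n → ℝ}
    (hb : ∀ k, 0 ≤ b k ∧ b k ≤ 1) {s : ℝ} (hs0 : 0 ≤ s) (hs : s * (2 * ℓ) ≤ 1) :
    Real.exp (s * ∑ k ∈ T, (2 * b k - b k ^ 2)) * (s * ∑ k ∈ T, (2 * b k - b k ^ 2)) ^ 2 ≤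
      ℓ * (4 * s ^ 2 * ∑ k ∈ T, b k ^ 2) := by
  rcases T.eq_empty_or_nonempty with rfl | hne
  · simp
  have hN : (0 : ℝ) < #T := Nat.cast_pos.2 hne.card_pos
  have hNℓ : (#T : ℝ) ≤ ℓ := Nat.cast_le.2 hT
  set N : ℝ := ((#T : ℕ) : ℝ)
  set q := ∑ k ∈ T, b k ^ 2 with hq
  have hq0 : 0 ≤ q := sum_nonneg fun _ _ => sq_nonneg _
  set r := (∑ k ∈ T, b k) / N with hr
  have hrN : ∑ k ∈ T, b k = N * r := by rw [hr]; field_simp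
  have hr0 : 0 ≤ r := div_nonneg (sum_nonneg fun k _ => (hb k).1) hN.le
  have hr1 : r ≤ 1 := by
    rw [hr, div_le_one hN]
    simpa using sum_le_card_nsmul T b 1 fun k _ => (hb k).2
  have hcs : N * r ^ 2 ≤ q := by
    have : (∑ k ∈ T, b k) ^ 2 ≤ N * q := sq_sum_le_card_mul_sum_sq
    rw [hrN] at this
    nlinarith
  have hX : s * ∑ k ∈ T, (2 * b k - b k ^ 2) ≤ 2 * s * N * (r * (1 - r / 2)) := by
    rw [sum_sub_distrib, ← mul_sum, hrN, ← hq]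
    nlinarith
  have hX0 : 0 ≤ s * ∑ k ∈ T, (2 * b k - b k ^ 2) :=
    mul_nonneg hs0 (sum_nonneg fun k _ => by nlinarith [(hb k).1, (hb k).2])
  have hsN : 2 * s * N ≤ 1 := by nlinarith
  have hX1 : 2 * s * N * (r * (1 - r / 2)) ≤ r := by
    have : 0 ≤ r * (1 - r / 2) := mul_nonneg hr0 (by linarith)
    nlinarith
  have hexp : Real.exp r * (1 - r / 2) ^ 2 ≤ 1 := by
    have h1 : (1 - r / 2) ^ 2 ≤ Real.exp (-(r / 2)) ^ 2 :=
      pow_le_pow_left₀ (by linarith) (Real.one_sub_le_exp_neg _) 2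
    have h2 : Real.exp (-(r / 2)) ^ 2 = Real.exp (-r) := by
      rw [sq, ← Real.exp_add]; ring_nf
    rw [h2] at h1
    calc _ ≤ Real.exp r * Real.exp (-r) := mul_le_mul_of_nonneg_left h1 (Real.exp_pos _).le
      _ = 1 := by rw [← Real.exp_add]; simp
  clear_value N
  calc _ ≤ Real.exp r * (2 * s * N * (r * (1 - r / 2))) ^ 2 :=
        mul_le_mul (Real.exp_le_exp.2 (hX.trans hX1)) (pow_le_pow_left₀ hX0 hX 2) (sq_nonneg _)
          (Real.exp_pos _).le
    _ = (Real.exp r * (1 - r / 2) ^ 2) * (4 * s ^ 2 * (N * (N * r ^ 2))) := by ring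
    _ ≤ 1 * (4 * s ^ 2 * (ℓ * q)) := by
        refine mul_le_mul hexp (mul_le_mul_of_nonneg_left ?_ (by positivity)) (by positivity)
          zero_le_one
        exact mul_le_mul hNℓ hcs (by positivity) (by positivity)
    _ = _ := by ring

theorem gmean_convex_distance_le (hG : IsLLocal ℓ G) (hℓ : 0 < ℓ) {φ : Perm (Fin n) → ℝ}
    {β : Perm (Fin n) → Fin n → ℝ} (hβ : ∀ x k, 0 ≤ β x k ∧ β x k ≤ 1)
    (hβφ : ∀ x, ∑ k, β x k ^ 2 ≤ φ x)
    (hφ : ∀ x y, ∀ T : Finset (Fin n), (∀ k ∉ T, x k = y k) →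
        φ x - φ y ≤ ∑ k ∈ T, (2 * β x k - β x k ^ 2))
    {r : ℝ} (hr : 0 < r) (hA : r ≤ ∑ σ ∈ univ.filter (fun σ => φ σ ≤ 0), unif G σ) :
    gmean G φ ≤ 2 * ((ℓ : ℝ) ^ 2 + ℓ) * -Real.log r := by
  have hℓ' : (0 : ℝ) < ℓ := Nat.cast_pos.2 hℓ
  set s₀ : ℝ := 1 / (2 * ℓ) with hs₀
  have hs0 : 0 < s₀ := by positivity
  have hE := log_gmean_exp_le_of_expEntropy_le (G := G) (fun x => - φ x) hs0 0 (-(2 * (ℓ : ℝ) ^ 2))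
    fun s h0 hs => by
    have hsum : ∀ T : Finset (Fin n),
        ∑ k ∈ T, 4 * s ^ 2 * gmean G (fun x => Real.exp (s * -φ x) * β x k ^ 2) =
        4 * s ^ 2 * gmean G fun x => Real.exp (s * -φ x) * ∑ k ∈ T, β x k ^ 2 := by
      intro T
      simp only [mul_sum]
      rw [gmean_sum, mul_sum]
    have h1 : expEntropy G (fun x => s * -φ x) ≤ 1 / 2 * (ℓ : ℝ) ^ 2 *
        (4 * s ^ 2 * gmean G fun x => Real.exp (s * -φ x) * ∑ k, β x k ^ 2) := by
      rw [← hsum univ]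
      refine hG.expEntropy_le (fun k => mul_nonneg (by positivity) (gmean_nonneg fun x _ =>
        mul_nonneg (Real.exp_pos _).le (sq_nonneg _))) fun t ht hdeg => ?_
      rw [hsum, decrease, ← gmean_const_mul, ← gmean_const_mul,
        ← gmean_mul_right (G.inv_mem ht)]
      refine gmean_mono fun x hx => ?_
      simp only [inv_mul_cancel_right]
      have hX := hφ x (x * t⁻¹) (univ.filter fun k => t k ≠ k) fun k hk => by
        have : t k = k := by simpa using hk
        have : t⁻¹ k = k := Perm.inv_eq_iff_eq.2 this.symm
        rw [Perm.mul_apply, this]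
      have hb := exp_mul_sq_le (T := univ.filter fun k => t k ≠ k) hdeg (hβ x) h0.le (by
        calc s * (2 * ℓ) ≤ s₀ * (2 * ℓ) := mul_le_mul_of_nonneg_right hs (by positivity)
          _ = 1 := by rw [hs₀]; field_simp)
      set X := ∑ k with t k ≠ k, (2 * β x k - β x k ^ 2) with hXdef
      have hd : s * -φ (x * t⁻¹) - s * -φ x ≤ s * X := by
        have := mul_le_mul_of_nonneg_left hX h0.le
        linarith
      have he : Real.exp (s * -φ (x * t⁻¹)) * max 0 (s * -φ (x * t⁻¹) - s * -φ x) ^ 2 ≤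
          Real.exp (s * -φ x) * (Real.exp (s * X) * (s * X) ^ 2) := by
        rcases le_total (s * -φ (x * t⁻¹) - s * -φ x) 0 with h | h
        · rw [max_eq_left h]
          have : 0 ≤ Real.exp (s * -φ x) * (Real.exp (s * X) * (s * X) ^ 2) := by positivity
          simpa using this
        · rw [max_eq_right h, ← mul_assoc, ← Real.exp_add]
          exact mul_le_mul (Real.exp_le_exp.2 (by linarith)) (pow_le_pow_left₀ h hd 2)
            (sq_nonneg _) (Real.exp_pos _).le
      refine he.trans ?_
      have := mul_le_mul_of_nonneg_left hb (Real.exp_pos (s * -φ x)).le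
      linarith
    have h2 : gmean G (fun x => Real.exp (s * -φ x) * ∑ k, β x k ^ 2) ≤
        - gmean G (fun x => Real.exp (s * -φ x) * -φ x) := by
      rw [neg_eq_neg_one_mul, ← gmean_const_mul]
      refine gmean_mono fun x _ => ?_
      have := mul_le_mul_of_nonneg_left (hβφ x) (Real.exp_pos (s * -φ x)).le
      linarith
    have h3 := mul_le_mul_of_nonneg_left h2 (by positivity : 0 ≤ 2 * (ℓ : ℝ) ^ 2 * s ^ 2)
    linarith
  set L := Real.log (gmean G fun x => Real.exp (s₀ * -φ x)) with hL
  have hneg : gmean G (fun x => -φ x) = - gmean G φ := by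
    rw [neg_eq_neg_one_mul, ← gmean_const_mul]; exact gmean_congr fun x _ => by ring
  have hrL : Real.log r ≤ L := by
    refine Real.log_le_log hr (hA.trans ?_)
    unfold gmean
    refine le_trans (sum_le_sum fun σ hσ => ?_) (sum_le_sum_of_subset_of_nonneg (filter_subset _ _)
      fun σ _ _ => mul_nonneg (unif_nonneg G σ) (Real.exp_pos _).le)
    refine le_mul_of_one_le_right (unif_nonneg G σ) (Real.one_le_exp ?_)
    have := (mem_filter.1 hσ).2
    exact mul_nonneg hs0.le (by linarith)
  rw [hneg, hs₀] at hE
  have hE' : L * (2 * ℓ) ≤ -gmean G φ + -(2 * (ℓ : ℝ) ^ 2) * L := by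
    have := mul_le_mul_of_nonneg_right hE (by positivity : (0 : ℝ) ≤ 2 * ℓ)
    refine this.trans (le_of_eq ?_)
    field_simp; ring
  nlinarith [mul_le_mul_of_nonneg_left hrL (by positivity : (0 : ℝ) ≤ (ℓ : ℝ) ^ 2 + ℓ)]

theorem gmean_mul_sq_le (X Y : Perm (Fin n) → ℝ) :
    gmean G (fun σ => X σ * Y σ) ^ 2 ≤ gmean G (fun σ => X σ ^ 2) * gmean G (fun σ => Y σ ^ 2) := by
  have h := sum_mul_sq_le_sq_mul_sq univ (fun σ => √(unif G σ) * X σ) (fun σ => √(unif G σ) * Y σ)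
  have e := fun σ => Real.mul_self_sqrt (unif_nonneg G σ)
  have e1 : ∀ σ, √(unif G σ) * X σ * (√(unif G σ) * Y σ) = unif G σ * (X σ * Y σ) := fun σ => by
    linear_combination (X σ * Y σ) * e σ
  simp only [e1, mul_pow, Real.sq_sqrt (unif_nonneg G _)] at h
  exact h

theorem lower_tail_le_of_sq_add_le (hG : IsLLocal ℓ G) (hℓ : 0 < ℓ) (g : Perm (Fin n) → ℝ)
    (a : Fin n → Perm (Fin n) → ℝ) (ha : ∀ k, ∀ σ ∈ G, 0 ≤ a k σ)
    (hconf : ∀ σ ∈ G, ∀ τ ∈ G,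
      g τ - g σ ≤ ∑ k : Fin n, a k τ * (if τ k ≠ σ k then (1 : ℝ) else 0))
    {c : ℝ} (hc : (ℓ : ℝ) ^ 2 + ℓ ≤ c) {u : ℝ} (hu : 0 ≤ u) :
    ∑ σ ∈ univ.filter (fun σ => g σ ≤ gmean G g - u), unif G σ ≤
      Real.exp (-(u ^ 2) / (2 * c * gmean G fun σ => ∑ k, a k σ ^ 2)) := by
  set V := gmean G fun σ => ∑ k, a k σ ^ 2 with hV
  have hV0 : 0 ≤ V := gmean_nonneg fun _ _ => sum_nonneg fun _ _ => sq_nonneg _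
  have hc0 : 0 < c := lt_of_lt_of_le (by positivity) hc
  rcases hV0.eq_or_lt with h | hVpos
  · rw [← h]; simpa using sum_unif_filter_le_one _
  set A : Finset (Perm (Fin n)) := univ.filter fun σ => σ ∈ G ∧ g σ ≤ gmean G g - u with hAdef
  set r := ∑ σ ∈ univ.filter (fun σ => g σ ≤ gmean G g - u), unif G σ with hr
  have hrA : r = ∑ σ ∈ A, unif G σ := by
    refine (sum_subset (fun σ hσ => ?_) fun σ hσ hσ' => unif_eq_zero fun h => hσ' ?_).symm
    · exact mem_filter.2 ⟨mem_univ _, (mem_filter.1 hσ).2.2⟩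
    · exact mem_filter.2 ⟨mem_univ _, h, (mem_filter.1 hσ).2⟩
  rcases A.eq_empty_or_nonempty with hA | hA
  · rw [hrA, hA, sum_empty]; exact (Real.exp_pos _).le
  have hr0 : 0 < r := by
    rw [hrA]
    refine sum_pos (fun σ hσ => ?_) hA
    rw [unif, if_pos (mem_filter.1 hσ).2.1, inv_pos]
    exact_mod_cast Nat.card_pos
  obtain ⟨φ, β, hβ, hφ0, hφA, hβφ, hφ, hdist⟩ := exists_convex_distance A hA
  have hmean := gmean_convex_distance_le hG hℓ hβ hβφ hφ hr0 (by
    rw [hrA]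
    exact sum_le_sum_of_subset_of_nonneg
      (fun σ hσ => mem_filter.2 ⟨mem_univ _, hφA σ hσ⟩) fun σ _ _ => unif_nonneg G σ)
  have hpt : u ≤ gmean G fun x => √(∑ k, a k x ^ 2) * √(φ x) := by
    have : gmean G (fun x => g x - (gmean G g - u)) ≤
        gmean G fun x => √(∑ k, a k x ^ 2) * √(φ x) := by
      refine gmean_mono fun x hx => le_trans ?_ (hdist x (fun k => a k x) fun k => ha k x hx)
      refine le_inf' _ _ fun z hz => ?_
      have hz' := (mem_filter.1 hz).2
      linarith [hconf z hz'.1 x hx]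
    rw [gmean_sub, gmean_const] at this
    linarith
  have hcs := gmean_mul_sq_le (G := G) (fun x => √(∑ k, a k x ^ 2)) (fun x => √(φ x))
  simp only [Real.sq_sqrt (hφ0 _),
    Real.sq_sqrt (sum_nonneg fun k (_ : k ∈ univ) => sq_nonneg (a k _))] at hcs
  have hr1 : Real.log r ≤ 0 := Real.log_nonpos hr0.le (sum_unif_filter_le_one _)
  rw [← Real.log_le_iff_le_exp hr0, neg_div, le_neg, div_le_iff₀ (by positivity)]
  have h1 : u ^ 2 ≤ V * gmean G φ := (pow_le_pow_left₀ hu hpt 2).trans hcs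
  have h2 : gmean G φ ≤ 2 * c * -Real.log r := hmean.trans (by nlinarith)
  nlinarith [mul_le_mul_of_nonneg_left h2 hV0]

theorem sq_sum_mul_le {ι : Type*} [Fintype ι] {q : ι → ℝ} (hq : ∀ i, 0 ≤ q i)
    (hq1 : ∑ i, q i = 1) (z : ι → ℝ) : (∑ i, q i * z i) ^ 2 ≤ ∑ i, q i * z i ^ 2 := by
  have := weighted_chebyshev q z z hq fun i j => mul_self_nonneg _
  simpa only [hq1, one_mul, ← sq] using this

theorem sq_gmean_le (z : Perm (Fin n) → ℝ) : gmean G z ^ 2 ≤ gmean G fun σ => z σ ^ 2 :=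
  sq_sum_mul_le (unif_nonneg G) (sum_unif G) z

/-- `q i l` is, whenever some element of `G` maps `i` to `l`, a probability measure on such
elements, in such a way that no point is moved too often. -/
structure IsTable (C : ℝ) (G : Subgroup (Perm (Fin n)))
    (q : Fin n → Fin n → Perm (Fin n) → ℝ) : Prop where
  nonneg : ∀ s ∈ G, ∀ i τ, 0 ≤ q i (s i) τ
  sum_eq : ∀ s ∈ G, ∀ i, ∑ τ, q i (s i) τ = 1
  mem : ∀ s ∈ G, ∀ i τ, q i (s i) τ ≠ 0 → τ ∈ G ∧ τ i = s i
  sum_le : ∀ s ∈ G, ∀ a : Fin n → ℝ, (∀ v, 0 ≤ a v) →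
    ∑ i, ∑ τ, q i (s i) τ * (∑ v with τ v ≠ v, a v) ^ 2 ≤ C * ∑ v, a v ^ 2

/-- Total `α`-weight of the points whose image under `x` is moved by `τ`. -/
def movedWeight (S : Finset (Fin n)) (α : Fin n → Perm (Fin n) → ℝ) (x τ : Perm (Fin n)) : ℝ :=
  ∑ k ∈ S, α k x * if τ (x k) ≠ x k then (1 : ℝ) else 0

theorem movedWeight_nonneg {S : Finset (Fin n)} {α : Fin n → Perm (Fin n) → ℝ}
    (hα : ∀ k, ∀ x ∈ G, 0 ≤ α k x) {x : Perm (Fin n)} (hx : x ∈ G) (τ : Perm (Fin n)) :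
    0 ≤ movedWeight S α x τ :=
  sum_nonneg fun k _ => mul_nonneg (hα k x hx) (by split_ifs <;> norm_num)

theorem movedWeight_eq (S : Finset (Fin n)) (α : Fin n → Perm (Fin n) → ℝ) (x τ : Perm (Fin n)) :
    movedWeight S α x τ = ∑ v with τ v ≠ v, if x⁻¹ v ∈ S then α (x⁻¹ v) x else 0 := by
  have h : movedWeight S α x τ =
      ∑ k, if τ (x k) ≠ x k then (if x⁻¹ (x k) ∈ S then α (x⁻¹ (x k)) x else 0) else 0 := by
    unfold movedWeight
    rw [← univ_inter S, ← sum_ite_mem]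
    refine sum_congr rfl fun k _ => ?_
    rw [show x⁻¹ (x k) = k from x.symm_apply_apply k, univ_inter]
    split_ifs <;> simp
  rw [h, sum_filter]
  exact Equiv.sum_comp x fun v => if τ v ≠ v then (if x⁻¹ v ∈ S then α (x⁻¹ v) x else 0) else 0

theorem sum_table_movedWeight_le {C : ℝ} {q : Fin n → Fin n → Perm (Fin n) → ℝ}
    (hq : IsTable C G q) (S : Finset (Fin n)) {α : Fin n → Perm (Fin n) → ℝ}
    (hα : ∀ k, ∀ x ∈ G, 0 ≤ α k x) {x y : Perm (Fin n)} (hx : x ∈ G) (hy : y ∈ G) :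
    ∑ j ∈ S, ∑ τ, q (x j) (y j) τ * movedWeight S α x τ ^ 2 ≤ C * ∑ k ∈ S, α k x ^ 2 := by
  have hs : y * x⁻¹ ∈ G := G.mul_mem hy (G.inv_mem hx)
  have hsx : ∀ j, (y * x⁻¹) (x j) = y j := fun j => by
    rw [Perm.mul_apply, show x⁻¹ (x j) = j from x.symm_apply_apply j]
  have h0 : ∀ j, 0 ≤ ∑ τ, q (x j) (y j) τ * movedWeight S α x τ ^ 2 := fun j =>
    sum_nonneg fun τ _ => mul_nonneg (hsx j ▸ hq.nonneg _ hs (x j) τ) (sq_nonneg _)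
  refine (sum_le_sum_of_subset_of_nonneg (subset_univ S) fun j _ _ => h0 j).trans ?_
  have h1 := hq.sum_le _ hs (fun v => if x⁻¹ v ∈ S then α (x⁻¹ v) x else 0) fun v => by
    split_ifs
    · exact hα _ x hx
    · exact le_rfl
  have h2 : ∑ v, (if x⁻¹ v ∈ S then α (x⁻¹ v) x else 0) ^ 2 = ∑ k ∈ S, α k x ^ 2 := by
    rw [← Equiv.sum_comp x fun v => (if x⁻¹ v ∈ S then α (x⁻¹ v) x else 0) ^ 2]
    rw [← univ_inter S, ← sum_ite_mem]
    refine sum_congr rfl fun k _ => ?_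
    rw [show x⁻¹ (x k) = k from x.symm_apply_apply k, univ_inter]
    split_ifs <;> simp
  rw [h2, ← Equiv.sum_comp x] at h1
  simpa only [hsx, movedWeight_eq] using h1

/-- The conclusion of the entropy method for groups fixing all points outside `S`. -/
def ConfigBound (C : ℝ) (S : Finset (Fin n)) (G : Subgroup (Perm (Fin n))) : Prop :=
  ∀ (f g : Perm (Fin n) → ℝ) (α : Fin n → Perm (Fin n) → ℝ), (∀ k, ∀ x ∈ G, 0 ≤ α k x) →
    (∀ x ∈ G, ∀ y ∈ G, f y ≤ g x + ∑ k ∈ S, α k x * if x k ≠ y k then (1 : ℝ) else 0) →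
    Real.log (gmean G fun x => Real.exp (f x)) ≤
      gmean G fun x => g x + 1 / 2 * C * ∑ k ∈ S, α k x ^ 2

theorem ConfigBound.log_gmean_coset_le {C : ℝ} {S : Finset (Fin n)} {j : Fin n}
    (hstab : ConfigBound C (S.erase j) (stab G j)) {f g : Perm (Fin n) → ℝ}
    {α : Fin n → Perm (Fin n) → ℝ} (hα : ∀ k, ∀ x ∈ G, 0 ≤ α k x)
    (hf : ∀ x ∈ G, ∀ y ∈ G, f y ≤ g x + ∑ k ∈ S, α k x * if x k ≠ y k then (1 : ℝ) else 0)
    {x y τ : Perm (Fin n)} (hx : x ∈ G) (hy : y ∈ G) (hτ : τ ∈ G) (hxy : τ (x j) = y j) :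
    Real.log (gmean (stab G j) fun h => Real.exp (f (y * h))) ≤
      gmean (stab G j) (fun h => g (x * h) + 1 / 2 * C * ∑ k ∈ S.erase j, α k (x * h) ^ 2) +
        gmean (stab G j) fun h => movedWeight S α (x * h) τ := by
  have hm : ∀ h ∈ stab G j, x * h ∈ G := fun h hh => G.mul_mem hx (stab_le G j hh)
  have := hstab (fun h => f (τ * x * h)) (fun h => g (x * h) + movedWeight S α (x * h) τ)
    (fun k h => α k (x * h)) (fun k h hh => hα k _ (hm h hh)) fun h hh h' hh' => by
      have h1 := hf (x * h) (hm h hh) (τ * x * h')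
        (G.mul_mem (G.mul_mem hτ hx) (stab_le G j hh'))
      have h2 : ∑ k ∈ S.erase j, α k (x * h) * (if h k ≠ h' k then (1 : ℝ) else 0) =
          ∑ k ∈ S, α k (x * h) * if h k ≠ h' k then (1 : ℝ) else 0 := by
        refine sum_erase S ?_
        rw [(mem_stab.1 hh).2, (mem_stab.1 hh').2]
        simp
      rw [h2, add_assoc, movedWeight, ← sum_add_distrib]
      refine h1.trans (add_le_add_right (sum_le_sum fun k _ => ?_) _)
      have hk := hα k _ (hm h hh)
      by_cases hhk : h k = h' k
      · simp only [Perm.mul_apply, hhk, ne_eq, not_true_eq_false, if_false, mul_zero, add_zero]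
        by_cases e : τ (x (h' k)) = x (h' k)
        · simp [e]
        · simp [e, Ne.symm e]
      · simp only [ne_eq, hhk, not_false_eq_true, if_true, mul_one]
        split_ifs <;> linarith
  rw [gmean_coset_eq (G.mul_mem hτ hx) hy hxy (fun z => Real.exp (f z))] at this
  refine this.trans (le_of_eq ?_)
  rw [← gmean_add]
  exact gmean_congr fun h _ => by ring

theorem ConfigBound.log_gmean_le_of_stab {C : ℝ} {q : Fin n → Fin n → Perm (Fin n) → ℝ}
    (hq : IsTable C G q) {S : Finset (Fin n)} {j : Fin n}
    (hstab : ConfigBound C (S.erase j) (stab G j)) {f g : Perm (Fin n) → ℝ}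
    {α : Fin n → Perm (Fin n) → ℝ} (hα : ∀ k, ∀ x ∈ G, 0 ≤ α k x)
    (hf : ∀ x ∈ G, ∀ y ∈ G, f y ≤ g x + ∑ k ∈ S, α k x * if x k ≠ y k then (1 : ℝ) else 0) :
    Real.log (gmean G fun x => Real.exp (f x)) ≤
      gmean G (fun x => g x + 1 / 2 * C * ∑ k ∈ S.erase j, α k x ^ 2) +
        1 / 2 * (gmean G (fun x => gmean G fun y => Real.exp (f y) *
          ∑ τ, q (x j) (y j) τ * movedWeight S α x τ ^ 2) /
          gmean G fun x => Real.exp (f x)) := by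
  set G₁ := stab G j with hG₁
  have hle : G₁ ≤ G := stab_le G j
  have hm : ∀ x ∈ G, ∀ h ∈ G₁, x * h ∈ G := fun x hx h hh => G.mul_mem hx (hle hh)
  have hmj : ∀ x, ∀ h ∈ G₁, (x * h) j = x j := fun x h hh => by
    rw [Perm.mul_apply, (mem_stab.1 hh).2]
  have hxy : ∀ {x y : Perm (Fin n)}, x ∈ G → y ∈ G → ∃ s ∈ G, s (x j) = y j := fun {x y} hx hy =>
    ⟨y * x⁻¹, G.mul_mem hy (G.inv_mem hx), by
      rw [Perm.mul_apply, show x⁻¹ (x j) = j from x.symm_apply_apply j]⟩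
  have hq0 : ∀ {x y : Perm (Fin n)}, x ∈ G → y ∈ G → ∀ τ, 0 ≤ q (x j) (y j) τ :=
    fun {x y} hx hy τ => by
      obtain ⟨s, hs, h⟩ := hxy hx hy; rw [← h]; exact hq.nonneg s hs _ τ
  have hq1 : ∀ {x y : Perm (Fin n)}, x ∈ G → y ∈ G → ∑ τ, q (x j) (y j) τ = 1 :=
    fun {x y} hx hy => by
      obtain ⟨s, hs, h⟩ := hxy hx hy; rw [← h]; exact hq.sum_eq s hs _
  have hqm : ∀ {x y : Perm (Fin n)}, x ∈ G → y ∈ G → ∀ τ, q (x j) (y j) τ ≠ 0 →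
      τ ∈ G ∧ τ (x j) = y j := fun {x y} hx hy τ hτ => by
    obtain ⟨s, hs, h⟩ := hxy hx hy; rw [← h] at hτ ⊢; exact hq.mem s hs _ τ hτ
  set F : Perm (Fin n) → ℝ := fun y => gmean G₁ fun h => Real.exp (f (y * h)) with hF
  have hF0 : ∀ y, 0 < F y := fun y => gmean_pos fun _ => Real.exp_pos _
  set A : Perm (Fin n) → ℝ := fun x => gmean G₁ fun h => g (x * h) +
    1 / 2 * C * ∑ k ∈ S.erase j, α k (x * h) ^ 2 with hA
  set B : Perm (Fin n) → Perm (Fin n) → ℝ := fun x y => ∑ τ, q (x j) (y j) τ *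
    gmean G₁ fun h => movedWeight S α (x * h) τ with hB
  have hB0 : ∀ x y, x ∈ G → y ∈ G → 0 ≤ B x y := fun x y hx hy => sum_nonneg fun τ _ =>
    mul_nonneg (hq0 hx hy τ) (gmean_nonneg fun h hh => movedWeight_nonneg hα (hm x hx h hh) τ)
  have hkey := log_partitionFn_le_of_config (unif_nonneg G) (sum_unif G)
    (fun y => Real.log (F y)) A B
    (fun x y hx hy => hB0 x y (mem_of_unif_ne_zero hx) (mem_of_unif_ne_zero hy))
    (fun x hx => ?_) (fun x y hx hy => ?_)
  rotate_left
  · have hx := mem_of_unif_ne_zero hx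
    have := ConfigBound.log_gmean_coset_le hstab hα hf hx hx G.one_mem rfl
    have h0 : ∀ h, movedWeight S α (x * h) 1 = 0 := by simp [movedWeight]
    simp only [h0, gmean_const, add_zero] at this
    exact this
  · have hx := mem_of_unif_ne_zero hx
    have hy := mem_of_unif_ne_zero hy
    have h1 : ∑ τ, q (x j) (y j) τ * (Real.log (F y) - A x) ≤ B x y := by
      refine sum_le_sum fun τ _ => ?_
      rcases eq_or_ne (q (x j) (y j) τ) 0 with h | h
      · simp [h]
      · obtain ⟨hτ, hτj⟩ := hqm hx hy τ h
        have := ConfigBound.log_gmean_coset_le hstab hα hf hx hy hτ hτj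
        exact mul_le_mul_of_nonneg_left (by linarith) (hq0 hx hy τ)
    rw [← sum_mul, hq1 hx hy, one_mul] at h1
    linarith
  simp only [partitionFn_unif, Real.exp_log (hF0 _)] at hkey
  have hZ : gmean G F = gmean G fun x => Real.exp (f x) :=
    gmean_tower hle fun x => Real.exp (f x)
  rw [hZ] at hkey
  set Z := gmean G fun x => Real.exp (f x) with hZdef
  have hZ0 : 0 < Z := gmean_pos fun _ => Real.exp_pos _
  refine hkey.trans ?_
  have hsplit : ∑ x, unif G x * (A x + 1 / 2 * ((∑ y, unif G y * F y * B x y ^ 2) / Z)) =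
      gmean G A + 1 / 2 * (gmean G (fun x => gmean G fun y => F y * B x y ^ 2) / Z) := by
    have e : ∀ x, ∑ y, unif G y * F y * B x y ^ 2 = gmean G fun y => F y * B x y ^ 2 := fun x =>
      sum_congr rfl fun y _ => by ring
    simp only [e]
    change gmean G (fun x => A x + 1 / 2 * (gmean G (fun y => F y * B x y ^ 2) / Z)) = _
    rw [gmean_add, gmean_const_mul]
    simp only [div_eq_mul_inv, gmean_mul_const]
  rw [hsplit]
  have hAmean : gmean G A = gmean G fun x => g x + 1 / 2 * C * ∑ k ∈ S.erase j, α k x ^ 2 :=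
    gmean_tower hle fun x => g x + 1 / 2 * C * ∑ k ∈ S.erase j, α k x ^ 2
  rw [hAmean]
  set K : Perm (Fin n) → Perm (Fin n) → ℝ := fun x y =>
    ∑ τ, q (x j) (y j) τ * movedWeight S α x τ ^ 2 with hK
  have hBK : ∀ x ∈ G, ∀ y ∈ G, B x y ^ 2 ≤ gmean G₁ fun h => K (x * h) y := by
    intro x hx y hy
    refine (sq_sum_mul_le (hq0 hx hy) (hq1 hx hy) _).trans ?_
    have : gmean G₁ (fun h => K (x * h) y) =
        ∑ τ, q (x j) (y j) τ * gmean G₁ fun h => movedWeight S α (x * h) τ ^ 2 := by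
      simp only [← gmean_const_mul]
      rw [← gmean_sum]
      exact gmean_congr fun h hh => by simp only [hK, hmj x h hh]
    rw [this]
    exact sum_le_sum fun τ _ => mul_le_mul_of_nonneg_left (sq_gmean_le _) (hq0 hx hy τ)
  have hfin : gmean G (fun x => gmean G fun y => F y * B x y ^ 2) ≤
      gmean G fun x => gmean G fun y => Real.exp (f y) * K x y := by
    calc _ ≤ gmean G fun x => gmean G fun y => F y * gmean G₁ fun h => K (x * h) y :=
          gmean_mono fun x hx => gmean_mono fun y hy =>
            mul_le_mul_of_nonneg_left (hBK x hx y hy) (hF0 y).le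
      _ = gmean G fun y => gmean G fun x => F y * K x y := by
          rw [gmean_comm]
          refine gmean_congr fun y _ => ?_
          rw [gmean_const_mul, gmean_const_mul, gmean_tower hle fun x => K x y]
      _ = gmean G fun x => gmean G fun y => F y * K x y := gmean_comm _
      _ = _ := by
          refine gmean_congr fun x _ => ?_
          rw [← gmean_tower hle fun y => Real.exp (f y) * K x y]
          refine gmean_congr fun y _ => ?_
          rw [hF, ← gmean_mul_const]
          exact gmean_congr fun h hh => by simp only [hK, hmj y h hh]
  have := div_le_div_of_nonneg_right hfin hZ0.le
  linarith

theorem configBound_of_tables {C : ℝ}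
    (htab : ∀ G : Subgroup (Perm (Fin n)), IsLLocal ℓ G → ∃ q, IsTable C G q)
    (S : Finset (Fin n)) :
    ∀ G : Subgroup (Perm (Fin n)), IsLLocal ℓ G → FixesOutside G S → ConfigBound C S G := by
  induction S using Finset.strongInduction with
  | H S ih =>
  intro G hG hS f g α hα hf
  rcases S.eq_empty_or_nonempty with rfl | hne
  · have h : ∀ φ : Perm (Fin n) → ℝ, gmean G φ = φ 1 := fun φ =>
      (gmean_congr fun σ hσ => by rw [hS.eq_one hσ]).trans (gmean_const G (φ 1))
    simpa [h] using hf 1 G.one_mem 1 G.one_mem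
  obtain ⟨q, hq⟩ := htab G hG
  set Z := gmean G fun x => Real.exp (f x) with hZ
  have hZ0 : 0 < Z := gmean_pos fun _ => Real.exp_pos _
  have hj : ∀ j ∈ S, Real.log Z ≤
      gmean G (fun x => g x + 1 / 2 * C * ∑ k ∈ S, α k x ^ 2) -
        1 / 2 * C * gmean G (fun x => α j x ^ 2) +
        1 / 2 * (gmean G (fun x => gmean G fun y => Real.exp (f y) *
          ∑ τ, q (x j) (y j) τ * movedWeight S α x τ ^ 2) / Z) := by
    intro j hj
    refine (ConfigBound.log_gmean_le_of_stab hq (ih _ (erase_ssubset hj) _ (hG.pointStab j)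
      (hS.pointStab j)) hα hf).trans (le_of_eq ?_)
    congr 1
    rw [← gmean_const_mul, ← gmean_sub]
    refine gmean_congr fun x _ => ?_
    rw [← sum_erase_add S _ hj]
    ring
  have hsum := sum_le_sum hj
  rw [sum_const, sum_add_distrib, sum_sub_distrib, sum_const, ← mul_sum, ← mul_sum, ← sum_div,
    ← gmean_sum, ← gmean_sum, nsmul_eq_mul, nsmul_eq_mul] at hsum
  have hlast : gmean G (fun x => ∑ j ∈ S, gmean G fun y => Real.exp (f y) *
      ∑ τ, q (x j) (y j) τ * movedWeight S α x τ ^ 2) / Z ≤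
      C * gmean G fun x => ∑ k ∈ S, α k x ^ 2 := by
    rw [div_le_iff₀ hZ0, ← gmean_const_mul C, ← gmean_mul_const Z]
    refine gmean_mono fun x hx => ?_
    rw [← gmean_sum, hZ, ← gmean_const_mul]
    refine gmean_mono fun y hy => ?_
    rw [← mul_sum, mul_comm]
    exact mul_le_mul_of_nonneg_right (sum_table_movedWeight_le hq S hα hx hy) (Real.exp_pos _).le
  have hcard : (0 : ℝ) < #S := Nat.cast_pos.2 hne.card_pos
  have : (#S : ℝ) * Real.log Z ≤
      #S * gmean G fun x => g x + 1 / 2 * C * ∑ k ∈ S, α k x ^ 2 := by linarith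
  exact le_of_mul_le_mul_left this hcard

theorem lower_tail_le_of_tables {C : ℝ} (hC : 0 ≤ C)
    (htab : ∀ G : Subgroup (Perm (Fin n)), IsLLocal ℓ G → ∃ q, IsTable C G q)
    (hG : IsLLocal ℓ G) (g : Perm (Fin n) → ℝ)
    (a : Fin n → Perm (Fin n) → ℝ) (ha : ∀ k, ∀ σ ∈ G, 0 ≤ a k σ)
    (hconf : ∀ σ ∈ G, ∀ τ ∈ G,
      g τ - g σ ≤ ∑ k : Fin n, a k τ * (if τ k ≠ σ k then (1 : ℝ) else 0))
    {u : ℝ} (hu : 0 ≤ u) :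
    ∑ σ ∈ univ.filter (fun σ => g σ ≤ gmean G g - u), unif G σ ≤
      Real.exp (-(u ^ 2) / (2 * C * gmean G fun σ => ∑ k, a k σ ^ 2)) := by
  set V := gmean G fun σ => ∑ k, a k σ ^ 2 with hV
  have hV0 : 0 ≤ V := gmean_nonneg fun _ _ => sum_nonneg fun _ _ => sq_nonneg _
  rcases (mul_nonneg hC hV0).eq_or_lt with h | hCV
  · rw [mul_assoc, ← h]; simpa using sum_unif_filter_le_one _
  set s := u / (C * V) with hs
  have hs0 : 0 ≤ s := div_nonneg hu hCV.le
  have hlog := configBound_of_tables htab univ G hG (fun _ _ k hk => absurd (mem_univ k) hk)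
    (fun x => s * -g x) (fun x => s * -g x) (fun k x => s * a k x)
    (fun k x hx => mul_nonneg hs0 (ha k x hx)) fun x hx y hy => by
      have := mul_le_mul_of_nonneg_left (hconf y hy x hx) hs0
      simp only [mul_assoc, ← mul_sum]
      linarith
  have hmean : gmean G (fun x => s * -g x + 1 / 2 * C * ∑ k, (s * a k x) ^ 2) =
      -(s * gmean G g) + 1 / 2 * C * s ^ 2 * V := by
    rw [gmean_add, hV, ← gmean_const_mul (1 / 2 * C * s ^ 2), neg_eq_neg_one_mul,
      ← gmean_const_mul s, ← gmean_const_mul (-1)]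
    congr 1
    · exact gmean_congr fun x _ => by ring
    · refine gmean_congr fun x _ => ?_
      simp only [mul_pow, ← mul_sum]; ring
  rw [hmean] at hlog
  have h := sum_unif_ge_le (G := G) (fun σ => -g σ) hs0 (-(gmean G g - u))
  simp only [neg_le_neg_iff] at h
  refine h.trans (Real.exp_le_exp.2 ?_)
  have e : -(u ^ 2) / (2 * C * V) = 1 / 2 * C * s ^ 2 * V - s * u := by
    have h1 : C ≠ 0 := left_ne_zero_of_mul hCV.ne'
    have h2 : V ≠ 0 := right_ne_zero_of_mul hCV.ne'
    rw [hs]; field_simp; ring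
  rw [e]
  linarith

/-- `a → b → c → a` is a three-cycle belonging to `G`. -/
def HasThreeCycle (G : Subgroup (Perm (Fin n))) (a b c : Fin n) : Prop :=
  a ≠ b ∧ b ≠ c ∧ a ≠ c ∧ swap a b * swap b c ∈ G

theorem HasThreeCycle.conj {a b c : Fin n} (h : HasThreeCycle G a b c) {g : Perm (Fin n)}
    (hg : g ∈ G) : HasThreeCycle G (g a) (g b) (g c) := by
  obtain ⟨h1, h2, h3, h4⟩ := h
  refine ⟨g.injective.ne h1, g.injective.ne h2, g.injective.ne h3, ?_⟩
  rw [swap_apply_apply, swap_apply_apply]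
  have := G.mul_mem (G.mul_mem hg h4) (G.inv_mem hg)
  simpa only [mul_assoc, inv_mul_cancel_left] using this

theorem swap_mul_swap_apply_first {a b c : Fin n} (h1 : a ≠ b) (h3 : a ≠ c) :
    (swap a b * swap b c) a = b := by
  rw [Perm.mul_apply, swap_apply_of_ne_of_ne h1 h3, swap_apply_left]

theorem swap_mul_swap_apply_second {a b c : Fin n} (h2 : b ≠ c) (h3 : a ≠ c) :
    (swap a b * swap b c) b = c := by
  rw [Perm.mul_apply, swap_apply_left, swap_apply_of_ne_of_ne h3.symm h2.symm]

theorem swap_mul_swap_apply_third {a b c : Fin n} : (swap a b * swap b c) c = a := by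
  rw [Perm.mul_apply, swap_apply_right, swap_apply_right]

theorem HasThreeCycle.rotate {a b c : Fin n} (h : HasThreeCycle G a b c) :
    HasThreeCycle G b c a := by
  have := h.conj h.2.2.2
  rwa [swap_mul_swap_apply_first h.1 h.2.2.1, swap_mul_swap_apply_second h.2.1 h.2.2.1,
    swap_mul_swap_apply_third] at this

theorem HasThreeCycle.reverse {a b c : Fin n} (h : HasThreeCycle G a b c) :
    HasThreeCycle G c b a := by
  refine ⟨h.2.1.symm, h.1.symm, h.2.2.1.symm, ?_⟩
  have := G.inv_mem h.2.2.2
  rwa [mul_inv_rev, swap_inv, swap_inv, swap_comm b c, swap_comm a b] at this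

theorem HasThreeCycle.trans {a b c d : Fin n} (hc : HasThreeCycle G a b c)
    (hd : HasThreeCycle G a b d) (hcd : c ≠ d) : HasThreeCycle G a c d := by
  have hfix : (swap a b * swap b c) d = d := by
    rw [Perm.mul_apply, swap_apply_of_ne_of_ne hd.2.1.symm hcd.symm,
      swap_apply_of_ne_of_ne hd.2.2.1.symm hd.2.1.symm]
  have h := (hd.conj hc.2.2.2).conj hc.2.2.2
  rw [hfix, hfix, swap_mul_swap_apply_first hc.1 hc.2.2.1,
    swap_mul_swap_apply_second hc.2.1 hc.2.2.1, swap_mul_swap_apply_third] at h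
  exact h.reverse.rotate

theorem HasThreeCycle.join {k j m a b : Fin n} (hj : HasThreeCycle G k j a)
    (hm : HasThreeCycle G k m b) (hjm : j ≠ m) : HasThreeCycle G k j m := by
  rcases eq_or_ne a m with rfl | ham
  · exact hj
  rcases eq_or_ne b j with rfl | hbj
  · exact hm.reverse.rotate.rotate
  rcases eq_or_ne a b with rfl | hab
  · exact hj.reverse.rotate.rotate.trans hm.reverse.rotate.rotate hjm
  · have h := hj.conj hm.2.2.2
    have hfix : ∀ x, k ≠ x → m ≠ x → b ≠ x → (swap k m * swap m b) x = x := fun x h1 h2 h3 => by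
      rw [Perm.mul_apply, swap_apply_of_ne_of_ne h2.symm h3.symm,
        swap_apply_of_ne_of_ne h1.symm h2.symm]
    rw [swap_mul_swap_apply_first hm.1 hm.2.2.1, hfix j hj.1 hjm.symm hbj,
      hfix a hj.2.2.1 ham.symm hab.symm] at h
    exact (hj.rotate.trans h.rotate hm.1).reverse.rotate

theorem eq_swap_or_eq_swap_mul_swap {τ : Perm (Fin n)} (hd : degree τ ≤ 3) {i : Fin n}
    (hi : τ i ≠ i) : τ = swap i (τ i) ∨ (i ≠ τ (τ i) ∧ degree τ = 3 ∧
      τ = swap i (τ i) * swap (τ i) (τ (τ i))) := by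
  have hle : ∀ T : Finset (Fin n), (∀ x ∈ T, τ x ≠ x) → #T ≤ degree τ := fun T hT =>
    card_le_card fun x hx => mem_filter.2 ⟨mem_univ x, hT x hx⟩
  have hinj : ∀ {x y}, τ x = τ y → x = y := fun h => τ.injective h
  have hi2 : τ (τ i) ≠ τ i := fun h => hi (hinj h)
  rcases eq_or_ne (τ (τ i)) i with hr | hr
  · left
    ext x
    rcases eq_or_ne x i with rfl | h1
    · rw [swap_apply_left]
    rcases eq_or_ne x (τ i) with rfl | h2
    · rw [swap_apply_right, hr]
    rw [swap_apply_of_ne_of_ne h1 h2]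
    by_contra h3
    have h3 : τ x ≠ x := fun h => h3 (by rw [h])
    have := hle {i, τ i, x, τ x} (by
      simp only [mem_insert, mem_singleton]
      rintro y (rfl | rfl | rfl | rfl)
      exacts [hi, hi2, h3, fun h => h3 (hinj h)])
    rw [card_insert_of_notMem, card_insert_of_notMem, card_insert_of_notMem, card_singleton] at this
    · omega
    · simpa using h3.symm
    · simp only [mem_insert, mem_singleton, not_or]
      exact ⟨h2.symm, fun h => h1 (hinj h).symm⟩
    · simp only [mem_insert, mem_singleton, not_or]
      exact ⟨hi.symm, h1.symm, fun h => h2 (hinj (hr.trans h)).symm⟩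
  · right
    have hi3 : τ (τ (τ i)) ≠ τ (τ i) := fun h => hi2 (hinj h)
    have hcard : #{i, τ i, τ (τ i)} = 3 := by
      rw [card_insert_of_notMem, card_insert_of_notMem, card_singleton]
      · simpa using hi2.symm
      · simpa using ⟨hi.symm, hr.symm⟩
    have hmoved : ∀ x ∈ ({i, τ i, τ (τ i)} : Finset (Fin n)), τ x ≠ x := by
      simp only [mem_insert, mem_singleton]
      rintro y (rfl | rfl | rfl)
      exacts [hi, hi2, hi3]
    have hout : ∀ x, x ∉ ({i, τ i, τ (τ i)} : Finset (Fin n)) → τ x = x := fun x hx => by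
      by_contra h
      have := hle (insert x {i, τ i, τ (τ i)}) (forall_mem_insert _ _ _ |>.2 ⟨h, hmoved⟩)
      rw [card_insert_of_notMem hx] at this
      omega
    refine ⟨hr.symm, le_antisymm hd (hcard ▸ hle _ hmoved), ?_⟩
    ext x
    rcases eq_or_ne x i with rfl | h1
    · rw [swap_mul_swap_apply_first hi.symm hr.symm]
    rcases eq_or_ne x (τ i) with rfl | h2
    · rw [swap_mul_swap_apply_second hi2.symm hr.symm]
    rcases eq_or_ne x (τ (τ i)) with rfl | h3
    · rw [swap_mul_swap_apply_third]
      by_contra h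
      have h' : τ (τ (τ i)) ∉ ({i, τ i, τ (τ i)} : Finset (Fin n)) := by
        simp only [mem_insert, mem_singleton, not_or]
        exact ⟨fun e => h (by rw [e]), fun e => hr (hinj e), hi3⟩
      exact hi3 (hinj (hout _ h'))
    rw [Perm.mul_apply, swap_apply_of_ne_of_ne h2 h3, swap_apply_of_ne_of_ne h1 h2, hout]
    simp [h1, h2, h3]

theorem IsLLocal.swap_mem_of_two (hG : IsLLocal 2 G) {s : Perm (Fin n)} (hs : s ∈ G) (i : Fin n) :
    swap i (s i) ∈ G := by
  obtain ⟨τ, hτ, -, hd, hi⟩ := hG s hs i _ rfl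
  rw [← hi]
  rcases eq_or_ne (τ i) i with h | h
  · rw [h, swap_self]; exact G.one_mem
  · rcases eq_swap_or_eq_swap_mul_swap (hd.trans (by norm_num)) h with h | ⟨-, h, -⟩
    · rwa [← h]
    · omega

theorem IsLLocal.swap_mem_or_hasThreeCycle (hG : IsLLocal 3 G) {s : Perm (Fin n)} (hs : s ∈ G)
    (i : Fin n) : swap i (s i) ∈ G ∨ ∃ r, HasThreeCycle G i (s i) r := by
  obtain ⟨τ, hτ, -, hd, hi⟩ := hG s hs i _ rfl
  rw [← hi]
  rcases eq_or_ne (τ i) i with h | h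
  · left; rw [h, swap_self]; exact G.one_mem
  · rcases eq_swap_or_eq_swap_mul_swap hd h with h' | ⟨h1, -, h2⟩
    · left; rwa [← h']
    · exact Or.inr ⟨τ (τ i), h.symm, fun e => h (τ.injective e).symm, h1, by rwa [← h2]⟩

theorem sum_moved_swap_le {a : Fin n → ℝ} (ha : ∀ v, 0 ≤ a v) (i l : Fin n) :
    ∑ v with swap i l v ≠ v, a v ≤ if i ≠ l then a i + a l else 0 := by
  split_ifs with h
  · rw [← sum_pair h]
    refine sum_le_sum_of_subset_of_nonneg (fun v hv => ?_) fun v _ _ => ha v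
    by_contra hv'
    simp only [mem_insert, mem_singleton, not_or] at hv'
    exact (mem_filter.1 hv).2 (swap_apply_of_ne_of_ne hv'.1 hv'.2)
  · simp [not_not.1 h]

theorem sum_moved_swap_mul_swap_le {a : Fin n → ℝ} (ha : ∀ v, 0 ≤ a v) {i l r : Fin n}
    (h1 : i ≠ l) (h2 : l ≠ r) (h3 : i ≠ r) :
    ∑ v with (swap i l * swap l r) v ≠ v, a v ≤ a i + a l + a r := by
  rw [add_assoc, ← sum_pair h2, ← sum_insert (by simp [h1, h3])]
  refine sum_le_sum_of_subset_of_nonneg (fun v hv => ?_) fun v _ _ => ha v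
  by_contra hv'
  simp only [mem_insert, mem_singleton, not_or] at hv'
  refine (mem_filter.1 hv).2 ?_
  rw [Perm.mul_apply, swap_apply_of_ne_of_ne hv'.2.1 hv'.2.2, swap_apply_of_ne_of_ne hv'.1 hv'.2.1]

theorem IsLLocal.exists_isTable_of_two (hG : IsLLocal 2 G) : ∃ q, IsTable 4 G q := by
  refine ⟨fun i l τ => if τ = swap i l then 1 else 0, ⟨?_, ?_, ?_, ?_⟩⟩
  · intro s _ i τ; split_ifs <;> norm_num
  · intro s _ i; simp
  · intro s hs i τ h
    have h : τ = swap i (s i) := by by_contra h'; exact h (if_neg h')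
    rw [h]
    exact ⟨hG.swap_mem_of_two hs i, swap_apply_left i _⟩
  · intro s _ a ha
    simp only [ite_mul, one_mul, zero_mul, sum_ite_eq', mem_univ, if_true]
    calc ∑ i, (∑ v with swap i (s i) v ≠ v, a v) ^ 2 ≤ ∑ i, (2 * a i ^ 2 + 2 * a (s i) ^ 2) := by
          refine sum_le_sum fun i _ => ?_
          have h0 : 0 ≤ ∑ v with swap i (s i) v ≠ v, a v := sum_nonneg fun v _ => ha v
          have h1 : ∑ v with swap i (s i) v ≠ v, a v ≤ a i + a (s i) :=
            (sum_moved_swap_le ha i (s i)).trans (by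
              split_ifs
              · exact le_rfl
              · exact add_nonneg (ha _) (ha _))
          nlinarith [pow_le_pow_left₀ h0 h1 2, sq_nonneg (a i - a (s i))]
      _ = 4 * ∑ v, a v ^ 2 := by
          rw [sum_add_distrib, ← mul_sum, ← mul_sum, Equiv.sum_comp s fun v => a v ^ 2]; ring

/-- The points through which some three-cycle of `G` maps `l` back to `i`. -/
def thirdPoints (G : Subgroup (Perm (Fin n))) (i l : Fin n) : Finset (Fin n) :=
  univ.filter fun r => HasThreeCycle G i l r

/-- The points moved by some three-cycle of `G` through `r`, except `r` itself. -/
def cycleNeighbors (G : Subgroup (Perm (Fin n))) (r : Fin n) : Finset (Fin n) :=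
  univ.filter fun x => ∃ y, HasThreeCycle G r x y

theorem mem_thirdPoints {i l r : Fin n} : r ∈ thirdPoints G i l ↔ HasThreeCycle G i l r := by
  simp [thirdPoints]

theorem mem_cycleNeighbors {r x : Fin n} :
    x ∈ cycleNeighbors G r ↔ ∃ y, HasThreeCycle G r x y := by
  simp [cycleNeighbors]

theorem card_cycleNeighbors_le {i l r : Fin n} (h : HasThreeCycle G i l r) :
    #(cycleNeighbors G r) ≤ #(thirdPoints G i l) + 1 := by
  have hi : i ∈ cycleNeighbors G r := mem_cycleNeighbors.2 ⟨l, h.rotate.rotate⟩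
  have hl : l ∈ (cycleNeighbors G r).erase i :=
    mem_erase.2 ⟨h.1.symm, mem_cycleNeighbors.2 ⟨i, h.reverse⟩⟩
  have hr : r ∉ ((cycleNeighbors G r).erase i).erase l := fun hr => by
    obtain ⟨y, hy⟩ := mem_cycleNeighbors.1 (mem_of_mem_erase (mem_of_mem_erase hr))
    exact hy.1 rfl
  have hsub : insert r (((cycleNeighbors G r).erase i).erase l) ⊆ thirdPoints G i l := by
    intro x hx
    rw [mem_thirdPoints]
    rcases mem_insert.1 hx with rfl | hx
    · exact h
    obtain ⟨hxl, hx⟩ := mem_erase.1 hx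
    obtain ⟨hxi, hx⟩ := mem_erase.1 hx
    obtain ⟨y, hy⟩ := mem_cycleNeighbors.1 hx
    have h1 : HasThreeCycle G r i x := h.rotate.rotate.join hy hxi.symm
    exact h.rotate.rotate.reverse.rotate.trans h1.reverse.rotate hxl.symm
  have := card_le_card hsub
  rw [card_insert_of_notMem hr, card_erase_of_mem hl, card_erase_of_mem hi] at this
  omega

theorem card_filter_hasThreeCycle_le {s : Perm (Fin n)} (hs : s ∈ G) (r : Fin n) :
    #{i | HasThreeCycle G i (s i) r} + (if s r ≠ r then 1 else 0) ≤
      max 1 #(cycleNeighbors G r) := by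
  have hsub : ({i | HasThreeCycle G i (s i) r} : Finset (Fin n)) ⊆ cycleNeighbors G r :=
    fun i hi => mem_cycleNeighbors.2 ⟨s i, (mem_filter.1 hi).2.rotate.rotate⟩
  have hle := card_le_card hsub
  split_ifs with h
  · by_cases he : ({i | HasThreeCycle G i (s i) r} : Finset (Fin n)) = cycleNeighbors G r
    · rcases (cycleNeighbors G r).eq_empty_or_nonempty with h0 | ⟨k, hk⟩
      · simp [he, h0]
      exfalso
      have hC : ∀ i ∈ cycleNeighbors G r, HasThreeCycle G i (s i) r := fun i hi => by
        rw [← he] at hi; exact (mem_filter.1 hi).2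
      have hmap : ∀ i ∈ cycleNeighbors G r, s i ∈ cycleNeighbors G r := fun i hi =>
        mem_cycleNeighbors.2 ⟨i, (hC i hi).reverse⟩
      have h1 := (hC k hk).conj hs
      have h2 := hC _ (hmap k hk)
      have h3 : s r ∈ cycleNeighbors G r :=
        mem_cycleNeighbors.2 ⟨s k, (h2.trans h1 h.symm).rotate⟩
      have himg : (cycleNeighbors G r).image s = cycleNeighbors G r :=
        eq_of_subset_of_card_le (image_subset_iff.2 hmap)
          (card_image_of_injective _ s.injective).ge
      rw [← himg] at h3
      obtain ⟨k', hk', hkr⟩ := mem_image.1 h3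
      rw [s.injective hkr] at hk'
      exact (hC r hk').2.2.1 rfl
    · have := card_lt_card (hsub.ssubset_of_ne he)
      exact le_max_of_le_right this
  · exact le_max_of_le_right hle

theorem sum_inv_card_thirdPoints_le {s : Perm (Fin n)} (hs : s ∈ G) (r : Fin n) :
    ∑ i with HasThreeCycle G i (s i) r, (#(thirdPoints G i (s i)) : ℝ)⁻¹ ≤
      if s r ≠ r then 1 else 2 := by
  rcases (filter (fun i => HasThreeCycle G i (s i) r) univ).eq_empty_or_nonempty with h0 | ⟨i, hi⟩
  · rw [h0, sum_empty]; split_ifs <;> norm_num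
  have hi := (mem_filter.1 hi).2
  have h2 : 2 ≤ #(cycleNeighbors G r) := by
    rw [← card_pair hi.1]
    refine card_le_card fun x hx => ?_
    rcases mem_insert.1 hx with rfl | hx
    · exact mem_cycleNeighbors.2 ⟨_, hi.rotate.rotate⟩
    · rw [mem_singleton.1 hx]
      exact mem_cycleNeighbors.2 ⟨_, hi.reverse⟩
  have hcard := card_filter_hasThreeCycle_le hs r
  rw [max_eq_right (by omega)] at hcard
  set N := #(cycleNeighbors G r)
  have hN : (2 : ℝ) ≤ N := by exact_mod_cast h2
  calc _ ≤ ∑ i with HasThreeCycle G i (s i) r, ((N : ℝ) - 1)⁻¹ := by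
        refine sum_le_sum fun i hi => inv_anti₀ (by linarith) ?_
        have := card_cycleNeighbors_le (mem_filter.1 hi).2
        have : (N : ℝ) ≤ #(thirdPoints G i (s i)) + 1 := by exact_mod_cast this
        linarith
    _ = #{i | HasThreeCycle G i (s i) r} / ((N : ℝ) - 1) := by
        rw [sum_const, nsmul_eq_mul, div_eq_mul_inv]
    _ ≤ _ := by
        rw [div_le_iff₀ (by linarith)]
        split_ifs at hcard ⊢
        · have : (#{i | HasThreeCycle G i (s i) r} : ℝ) + 1 ≤ N := by exact_mod_cast hcard
          linarith
        · have : (#{i | HasThreeCycle G i (s i) r} : ℝ) ≤ N := by exact_mod_cast hcard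
          linarith

/-- The transposition of `i` and `l` if it belongs to `G`, and otherwise a uniformly chosen
three-cycle of `G` mapping `i` to `l`. -/
def threeTable (G : Subgroup (Perm (Fin n))) (i l : Fin n) (τ : Perm (Fin n)) : ℝ :=
  if swap i l ∈ G then if τ = swap i l then 1 else 0
  else ∑ r ∈ thirdPoints G i l, (#(thirdPoints G i l) : ℝ)⁻¹ *
    if τ = swap i l * swap l r then 1 else 0

theorem sum_threeTable_mul (i l : Fin n) (z : Perm (Fin n) → ℝ) :
    ∑ τ, threeTable G i l τ * z τ = if swap i l ∈ G then z (swap i l) else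
      ∑ r ∈ thirdPoints G i l, (#(thirdPoints G i l) : ℝ)⁻¹ * z (swap i l * swap l r) := by
  unfold threeTable
  split_ifs
  · simp
  · simp only [sum_mul]
    rw [sum_comm]
    refine sum_congr rfl fun r _ => ?_
    simp

theorem sum_threeTable_moved_sq_le (hG : IsLLocal 3 G) {s : Perm (Fin n)} (hs : s ∈ G)
    {a : Fin n → ℝ} (ha : ∀ v, 0 ≤ a v) (i : Fin n) :
    ∑ τ, threeTable G i (s i) τ * (∑ v with τ v ≠ v, a v) ^ 2 ≤
      (if i ≠ s i then 3 * a i ^ 2 + 3 * a (s i) ^ 2 else 0) +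
        3 * ∑ r ∈ thirdPoints G i (s i), (#(thirdPoints G i (s i)) : ℝ)⁻¹ * a r ^ 2 := by
  rw [sum_threeTable_mul]
  have h0 : ∀ τ : Perm (Fin n), 0 ≤ ∑ v with τ v ≠ v, a v := fun τ => sum_nonneg fun v _ => ha v
  split_ifs with h h' h'
  · have h1 := sum_moved_swap_le ha i (s i)
    rw [if_pos h'] at h1
    have h2 := pow_le_pow_left₀ (h0 _) h1 2
    have h3 : 0 ≤ ∑ r ∈ thirdPoints G i (s i), (#(thirdPoints G i (s i)) : ℝ)⁻¹ * a r ^ 2 := by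
      positivity
    nlinarith [sq_nonneg (a i - a (s i)), sq_nonneg (a i), sq_nonneg (a (s i))]
  · have h1 := sum_moved_swap_le ha i (s i)
    rw [if_neg h'] at h1
    rw [le_antisymm h1 (h0 _), zero_pow two_ne_zero, zero_add]
    positivity
  · have hne : (thirdPoints G i (s i)).Nonempty := by
      obtain ⟨r, hr⟩ := (hG.swap_mem_or_hasThreeCycle hs i).resolve_left h
      exact ⟨r, mem_thirdPoints.2 hr⟩
    have hE : (#(thirdPoints G i (s i)) : ℝ) ≠ 0 := Nat.cast_ne_zero.2 hne.card_pos.ne'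
    calc _ ≤ ∑ r ∈ thirdPoints G i (s i), (#(thirdPoints G i (s i)) : ℝ)⁻¹ *
          ((3 * a i ^ 2 + 3 * a (s i) ^ 2) + 3 * a r ^ 2) := by
          refine sum_le_sum fun r hr => mul_le_mul_of_nonneg_left ?_ (by positivity)
          obtain ⟨h1, h2, h3, -⟩ := mem_thirdPoints.1 hr
          have h4 := pow_le_pow_left₀ (h0 _) (sum_moved_swap_mul_swap_le ha h1 h2 h3) 2
          nlinarith [sq_nonneg (a i - a (s i)), sq_nonneg (a i - a r), sq_nonneg (a (s i) - a r)]
      _ = _ := by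
          simp only [mul_add (#(thirdPoints G i (s i)) : ℝ)⁻¹, sum_add_distrib, sum_const,
            nsmul_eq_mul, mul_sum]
          field_simp
  · exact absurd (by rw [← not_not.1 h', swap_self]; exact G.one_mem) h

theorem IsLLocal.exists_isTable_of_three (hG : IsLLocal 3 G) : ∃ q, IsTable 10 G q := by
  refine ⟨threeTable G, ⟨?_, ?_, ?_, ?_⟩⟩
  · intro s _ i τ
    unfold threeTable
    split_ifs <;> positivity
  · intro s hs i
    have := sum_threeTable_mul (G := G) i (s i) fun _ => 1
    simp only [mul_one] at this
    rw [this]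
    split_ifs with h
    · rfl
    · obtain ⟨r, hr⟩ := (hG.swap_mem_or_hasThreeCycle hs i).resolve_left h
      have : #(thirdPoints G i (s i)) ≠ 0 := (card_pos.2 ⟨r, mem_thirdPoints.2 hr⟩).ne'
      rw [sum_const, nsmul_eq_mul, mul_inv_cancel₀ (Nat.cast_ne_zero.2 this)]
  · intro s hs i τ h
    unfold threeTable at h
    split_ifs at h with h1 h2
    · rw [h2]; exact ⟨h1, swap_apply_left i _⟩
    · exact absurd rfl h
    · obtain ⟨r, hr, h⟩ := exists_ne_zero_of_sum_ne_zero h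
      obtain ⟨h2, -, h4, h5⟩ := mem_thirdPoints.1 hr
      have h6 : τ = swap i (s i) * swap (s i) r := by
        by_contra h'; exact h (by rw [if_neg h', mul_zero])
      rw [h6]
      exact ⟨h5, swap_mul_swap_apply_first h2 h4⟩
  · intro s hs a ha
    refine (sum_le_sum fun i _ => sum_threeTable_moved_sq_le hG hs ha i).trans ?_
    have hmoved : ∑ i, (if i ≠ s i then 3 * a i ^ 2 + 3 * a (s i) ^ 2 else 0) =
        ∑ r, if s r ≠ r then 6 * a r ^ 2 else 0 := by
      have h1 := Equiv.sum_comp s fun r => if s r ≠ r then 3 * a r ^ 2 else 0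
      have h2 : ∑ i, (if i ≠ s i then 3 * a i ^ 2 + 3 * a (s i) ^ 2 else 0) =
          ∑ i, (if s i ≠ i then 3 * a i ^ 2 else 0) +
            ∑ i, if s (s i) ≠ s i then 3 * a (s i) ^ 2 else 0 := by
        rw [← sum_add_distrib]
        refine sum_congr rfl fun i _ => ?_
        simp only [ne_eq, s.injective.eq_iff, eq_comm (a := i)]
        split_ifs <;> ring
      rw [h2, h1, ← sum_add_distrib]
      refine sum_congr rfl fun r _ => ?_
      split_ifs <;> ring
    have hthird : ∑ i, ∑ r ∈ thirdPoints G i (s i), (#(thirdPoints G i (s i)) : ℝ)⁻¹ * a r ^ 2 =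
        ∑ r, (∑ i with HasThreeCycle G i (s i) r, (#(thirdPoints G i (s i)) : ℝ)⁻¹) *
          a r ^ 2 := by
      simp only [sum_mul]
      exact sum_comm' (by simp [mem_thirdPoints])
    rw [sum_add_distrib, ← mul_sum, hmoved, hthird, mul_sum, mul_sum, ← sum_add_distrib]
    refine sum_le_sum fun r _ => ?_
    have h1 := mul_le_mul_of_nonneg_right (sum_inv_card_thirdPoints_le hs r) (sq_nonneg (a r))
    split_ifs at h1 ⊢ <;> linarith [sq_nonneg (a r)]

end

/-- Deviation inequalities for configuration functions under the uniform measure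
on an `ℓ`-local group, with `c² = 2(ℓ-1)² + 2`. -/
theorem stmt14 {n ℓ : ℕ} (hn : 2 ≤ n) (hℓ : 2 ≤ ℓ) (hℓn : ℓ ≤ n)
    (G : Subgroup (Equiv.Perm (Fin n))) (hG : IsLLocal ℓ G)
    (g : Equiv.Perm (Fin n) → ℝ) (a : Fin n → Equiv.Perm (Fin n) → ℝ)
    (ha : ∀ k : Fin n, ∀ σ ∈ G, 0 ≤ a k σ)
    (hconf : ∀ σ ∈ G, ∀ τ ∈ G,
      g τ - g σ ≤ ∑ k : Fin n, a k τ * (if τ k ≠ σ k then (1 : ℝ) else 0))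
    (u : ℝ) (hu : 0 ≤ u) :
    ((∑ σ ∈ Finset.univ.filter
        (fun σ : Equiv.Perm (Fin n) => g σ ≤ (∑ τ, g τ * unif G τ) - u), unif G σ) ≤
      Real.exp (-(u ^ 2) / (2 * (2 * ((ℓ : ℝ) - 1) ^ 2 + 2) *
        ∑ σ, (∑ k : Fin n, a k σ ^ 2) * unif G σ))) ∧
    ((∑ σ ∈ Finset.univ.filter
        (fun σ : Equiv.Perm (Fin n) => (∑ τ, g τ * unif G τ) + u ≤ g σ), unif G σ) ≤
      Real.exp (-(u ^ 2) / (2 * (2 * ((ℓ : ℝ) - 1) ^ 2 + 2) *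
        (⨆ σ : G, ∑ k : Fin n, a k (σ : Equiv.Perm (Fin n)) ^ 2)))) ∧
    (∀ M : ℝ, 0 ≤ M → (∀ σ ∈ G, (∑ k : Fin n, a k σ ^ 2) ≤ M * g σ) →
      (∑ σ ∈ Finset.univ.filter
          (fun σ : Equiv.Perm (Fin n) => (∑ τ, g τ * unif G τ) + u ≤ g σ), unif G σ) ≤
        Real.exp (-(u ^ 2) / (2 * (2 * ((ℓ : ℝ) - 1) ^ 2 + 2) * M *
          ((∑ τ, g τ * unif G τ) + u)))) := by
  have hmean : ∀ φ : Equiv.Perm (Fin n) → ℝ, ∑ τ, φ τ * unif G τ = gmean G φ := fun φ =>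
    Finset.sum_congr rfl fun τ _ => mul_comm _ _
  have hc : (ℓ : ℝ) ^ 2 ≤ 2 * ((ℓ : ℝ) - 1) ^ 2 + 2 := by nlinarith [sq_nonneg ((ℓ : ℝ) - 2)]
  simp only [hmean]
  refine ⟨?_, ?_, fun M hM hA => upper_tail_self_bounding_le hG g a hconf hc hM hA hu⟩
  · rcases (by omega : ℓ = 2 ∨ ℓ = 3 ∨ 4 ≤ ℓ) with rfl | rfl | h
    · convert lower_tail_le_of_tables (C := 4) (by norm_num)
        (fun G hG => hG.exists_isTable_of_two) hG g a ha hconf hu using 4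
      norm_num
    · convert lower_tail_le_of_tables (C := 10) (by norm_num)
        (fun G hG => hG.exists_isTable_of_three) hG g a ha hconf hu using 4
      norm_num
    · have h4 : (4 : ℝ) ≤ ℓ := by exact_mod_cast h
      exact lower_tail_le_of_sq_add_le hG (by omega) g a ha hconf (by nlinarith) hu
  · exact upper_tail_le hG g a hconf hc
      (fun σ hσ => le_ciSup (f := fun σ : G => ∑ k, a k (σ : Equiv.Perm (Fin n)) ^ 2)
        (Set.finite_range _).bddAbove ⟨σ, hσ⟩) hu

end
end

section
/- Let G be a subgroup of S_n with ℓ-local base T and let μ ∈ M_T. Then for every function φ : G → ℝ that is 1-Lipschitz with respect to the Hamming distance d_H, and every λ ≥ 0: ∑_{σ∈G} exp(λφ(σ)) μ(σ) ≤ exp( λ·∑_σ φ(σ)μ(σ) + K_n c² λ² / 8 ), where c = min(2ℓ−1, n). -/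
attribute [local instance] Classical.propDecidable

noncomputable section

/-- Hamming distance on permutations, as a real number. -/
noncomputable def dH {n : ℕ} (σ τ : Equiv.Perm (Fin n)) : ℝ :=
  ((Finset.univ.filter fun i => σ i ≠ τ i).card : ℝ)

/-- The subgroup `G_j` of elements of `G` fixing every index `> j`. -/
def Gj {n : ℕ} (G : Subgroup (Equiv.Perm (Fin n))) (j : Fin n) :
    Set (Equiv.Perm (Fin n)) :=
  {σ | σ ∈ G ∧ ∀ i : Fin n, j < i → σ i = i}

/-- The orbit `O_j` of `j` under `G_j`. -/
def Orb {n : ℕ} (G : Subgroup (Equiv.Perm (Fin n))) (j : Fin n) : Set (Fin n) :=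
  {i | ∃ σ ∈ Gj G j, σ j = i}

/-- An `ℓ`-local base of `G`. -/
def IsLocalBase {n : ℕ} (ℓ : ℕ) (G : Subgroup (Equiv.Perm (Fin n)))
    (t : Fin n → Fin n → Equiv.Perm (Fin n)) : Prop :=
  ∀ j : Fin n, (j : ℕ) ≠ 0 →
    t j j = 1 ∧ ∀ i ∈ Orb G j, i ≠ j →
      t i j ∈ Gj G j ∧ t i j i = j ∧ degree (t i j) ≤ ℓ

/-- The map `U_T (i_2, …, i_n) = t_{i_2,2} t_{i_3,3} ⋯ t_{i_n,n}`. -/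
noncomputable def UT {n : ℕ} (t : Fin n → Fin n → Equiv.Perm (Fin n))
    (i : Fin n → Fin n) : Equiv.Perm (Fin n) :=
  (((List.finRange n).drop 1).map fun j => t (i j) j).prod

/-- `μ` belongs to the class `M_T`: it is the pushforward under `U_T` of a product
of probability measures on the orbits `O_j`. -/
def MemMT {n : ℕ} (G : Subgroup (Equiv.Perm (Fin n)))
    (t : Fin n → Fin n → Equiv.Perm (Fin n)) (μ : Equiv.Perm (Fin n) → ℝ) : Prop :=
  ∃ νh : Fin n → Fin n → ℝ,
    (∀ j : Fin n,
      (∀ i, 0 ≤ νh j i) ∧ (∀ i, i ∉ Orb G j → νh j i = 0) ∧ ∑ i, νh j i = 1) ∧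
    ∀ σ, μ σ = ∑ i : Fin n → Fin n, if UT t i = σ then ∏ j, νh j (i j) else 0

/-- `K_n`, the number of indices `j ∈ {2, …, n}` with `O_j ≠ {j}`. -/
noncomputable def Kn {n : ℕ} (G : Subgroup (Equiv.Perm (Fin n))) : ℕ :=
  (Finset.univ.filter fun j : Fin n => (j : ℕ) ≠ 0 ∧ Orb G j ≠ {j}).card

/-- Hoeffding's lemma for a finitely supported probability vector `w`. -/
theorem sum_mul_exp_le_of_abs_sub_le {α : Type*} [Fintype α] (w g : α → ℝ) (c : ℝ)
    (hw : ∀ a, 0 ≤ w a) (hsum : ∑ a, w a = 1)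
    (hg : ∀ a b, w a ≠ 0 → w b ≠ 0 → |g a - g b| ≤ c) :
    ∑ a, w a * Real.exp (g a) ≤ Real.exp (∑ a, w a * g a + c ^ 2 / 8) := by
  let _ : MeasurableSpace α := ⊤
  let P : MeasureTheory.Measure α :=
    ∑ a, ENNReal.ofReal (w a) • MeasureTheory.Measure.dirac a
  have hP : MeasureTheory.IsProbabilityMeasure P := by
    constructor
    simp only [P, MeasureTheory.Measure.coe_finsetSum, Finset.sum_apply,
      MeasureTheory.Measure.smul_apply, MeasureTheory.measure_univ, smul_eq_mul, mul_one]
    rw [← ENNReal.ofReal_sum_of_nonneg fun a _ => hw a, hsum, ENNReal.ofReal_one]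
  have hint (h : α → ℝ) : ∫ a, h a ∂P = ∑ a, w a * h a := by
    simp only [P]
    rw [MeasureTheory.integral_finsetSum_measure]
    · refine Finset.sum_congr rfl fun a _ => ?_
      rw [MeasureTheory.integral_smul_measure, MeasureTheory.integral_dirac,
        ENNReal.toReal_ofReal (hw a), smul_eq_mul]
    · intro a _
      exact (MeasureTheory.integrable_dirac (by simp)).smul_measure ENNReal.ofReal_ne_top
  have hne : (Finset.univ.filter fun a => w a ≠ 0).Nonempty := by
    by_contra hcon
    rw [Finset.not_nonempty_iff_eq_empty, Finset.filter_eq_empty_iff] at hcon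
    have : ∑ a, w a = 0 := Finset.sum_eq_zero fun a ha => not_not.mp (hcon ha)
    linarith
  obtain ⟨a₀, ha₀, hmin⟩ := Finset.exists_min_image _ g hne
  have hwa₀ : w a₀ ≠ 0 := (Finset.mem_filter.mp ha₀).2
  have hrange : ∀ᵐ a ∂P, g a ∈ Set.Icc (g a₀) (g a₀ + c) := by
    rw [MeasureTheory.ae_iff]
    simp only [P, MeasureTheory.Measure.coe_finsetSum, Finset.sum_apply,
      MeasureTheory.Measure.smul_apply, smul_eq_mul]
    refine Finset.sum_eq_zero fun a _ => ?_
    by_cases ha : w a = 0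
    · simp [ha]
    · have h1 := hmin a (by simp [ha])
      have h2 := (abs_le.mp (hg a a₀ ha hwa₀)).2
      have h3 : g a ≤ g a₀ + c := by linarith
      simp [MeasureTheory.Measure.dirac_apply' a (MeasurableSpace.measurableSet_top), h1, h3]
  have hmgf := (ProbabilityTheory.hasSubgaussianMGF_of_mem_Icc
    (measurable_from_top (f := g)).aemeasurable hrange).mgf_le 1
  rw [ProbabilityTheory.mgf, hint, hint] at hmgf
  set m := ∑ a, w a * g a
  have hexp : ∑ a, w a * Real.exp (g a) =
      Real.exp m * ∑ a, w a * Real.exp (1 * (g a - m)) := by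
    rw [Finset.mul_sum]
    refine Finset.sum_congr rfl fun a _ => ?_
    rw [mul_left_comm, ← Real.exp_add]
    ring_nf
  rw [hexp, Real.exp_add]
  refine mul_le_mul_of_nonneg_left (hmgf.trans (Real.exp_le_exp.mpr (le_of_eq ?_)))
    (Real.exp_pos _).le
  have habs : |c| ^ 2 = c ^ 2 := sq_abs c
  simp only [add_sub_cancel_left, NNReal.coe_pow, NNReal.coe_div, coe_nnnorm, Real.norm_eq_abs,
    NNReal.coe_ofNat, one_pow, mul_one, div_pow, habs]
  ring

theorem sum_fin_succ_arrow {α : Type*} [Fintype α] {m : ℕ} (F : (Fin (m + 1) → α) → ℝ) :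
    ∑ x, F x = ∑ a, ∑ y : Fin m → α, F (Fin.cons a y) := by
  rw [← (Fin.consEquiv fun _ => α).sum_comp F, Fintype.sum_prod_type]
  rfl

theorem sum_prod_eq_one {α : Type*} [Fintype α] {m : ℕ} (w : Fin m → α → ℝ)
    (hsum : ∀ j, ∑ a, w j a = 1) : ∑ x : Fin m → α, ∏ j, w j (x j) = 1 := by
  rw [← Fintype.prod_sum]
  simp [hsum]

/-- The bounded differences (McDiarmid) inequality for a finite product of finitely supported
probability vectors. -/
theorem sum_prod_mul_exp_le_of_bounded_differences {α : Type*} [Fintype α] {m : ℕ}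
    (w : Fin m → α → ℝ) (c : Fin m → ℝ) (f : (Fin m → α) → ℝ)
    (hw : ∀ j a, 0 ≤ w j a) (hsum : ∀ j, ∑ a, w j a = 1)
    (hf : ∀ j x y, (∀ k, w k (x k) ≠ 0) → (∀ k, w k (y k) ≠ 0) → (∀ k, k ≠ j → x k = y k) →
      |f x - f y| ≤ c j) :
    ∑ x, (∏ j, w j (x j)) * Real.exp (f x) ≤
      Real.exp (∑ x, (∏ j, w j (x j)) * f x + (∑ j, c j ^ 2) / 8) := by
  induction m with
  | zero => simp
  | succ m ih =>
    have hsplit (h : (Fin (m + 1) → α) → ℝ) : ∑ x, (∏ j, w j (x j)) * h x =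
        ∑ a, w 0 a * ∑ y : Fin m → α, (∏ j, w j.succ (y j)) * h (Fin.cons a y) := by
      rw [sum_fin_succ_arrow]
      refine Finset.sum_congr rfl fun a _ => ?_
      rw [Finset.mul_sum]
      refine Finset.sum_congr rfl fun y _ => ?_
      simp [Fin.prod_univ_succ, mul_assoc]
    rw [hsplit, hsplit, Fin.sum_univ_succ]
    set g : α → ℝ := fun a => ∑ y : Fin m → α, (∏ j, w j.succ (y j)) * f (Fin.cons a y) with hg
    set C := (∑ j : Fin m, c j.succ ^ 2) / 8 with hC
    have hcond : ∀ a, w 0 a ≠ 0 →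
        ∑ y : Fin m → α, (∏ j, w j.succ (y j)) * Real.exp (f (Fin.cons a y)) ≤
          Real.exp (g a + C) := by
      intro a ha
      refine ih (fun j => w j.succ) (fun j => c j.succ) (fun y => f (Fin.cons a y))
        (fun j => hw j.succ) (fun j => hsum j.succ) fun j x y hx hy hxy =>
          hf j.succ _ _ (Fin.cases ha hx) (Fin.cases ha hy) (Fin.cases (fun _ => rfl) ?_)
      intro k hk
      exact hxy k fun h => hk (by rw [h])
    have hgdiff : ∀ a b, w 0 a ≠ 0 → w 0 b ≠ 0 → |g a - g b| ≤ c 0 := by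
      intro a b ha hb
      have hone := sum_prod_eq_one (fun j : Fin m => w j.succ) fun j => hsum j.succ
      rw [hg, ← Finset.sum_sub_distrib]
      calc |∑ y : Fin m → α, ((∏ j, w j.succ (y j)) * f (Fin.cons a y) -
              (∏ j, w j.succ (y j)) * f (Fin.cons b y))|
          ≤ ∑ y : Fin m → α, (∏ j, w j.succ (y j)) * c 0 := by
            refine (Finset.abs_sum_le_sum_abs _ _).trans (Finset.sum_le_sum fun y _ => ?_)
            rw [← mul_sub, abs_mul, abs_of_nonneg (Finset.prod_nonneg fun j _ => hw _ _)]
            by_cases hy : ∏ j, w j.succ (y j) = 0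
            · simp [hy]
            · have hy' : ∀ j, w j.succ (y j) ≠ 0 := fun j =>
                Finset.prod_ne_zero_iff.mp hy j (Finset.mem_univ j)
              refine mul_le_mul_of_nonneg_left (hf 0 _ _ (Fin.cases ha hy') (Fin.cases hb hy')
                (Fin.cases (fun h => absurd rfl h) fun k _ => rfl))
                (Finset.prod_nonneg fun j _ => hw _ _)
        _ = c 0 := by rw [← Finset.sum_mul, hone, one_mul]
    calc ∑ a, w 0 a * ∑ y : Fin m → α, (∏ j, w j.succ (y j)) * Real.exp (f (Fin.cons a y))
        ≤ ∑ a, w 0 a * Real.exp (g a + C) := by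
          refine Finset.sum_le_sum fun a _ => ?_
          by_cases ha : w 0 a = 0
          · simp [ha]
          · exact mul_le_mul_of_nonneg_left (hcond a ha) (hw 0 a)
      _ = (∑ a, w 0 a * Real.exp (g a)) * Real.exp C := by
          rw [Finset.sum_mul]
          exact Finset.sum_congr rfl fun a _ => by rw [Real.exp_add, mul_assoc]
      _ ≤ Real.exp (∑ a, w 0 a * g a + c 0 ^ 2 / 8) * Real.exp C :=
          mul_le_mul_of_nonneg_right
            (sum_mul_exp_le_of_abs_sub_le (w 0) g (c 0) (hw 0) (hsum 0) hgdiff)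
            (Real.exp_pos _).le
      _ = Real.exp (∑ a, w 0 a * g a + (c 0 ^ 2 + ∑ j : Fin m, c j.succ ^ 2) / 8) := by
          rw [← Real.exp_add, hC]
          ring_nf

theorem dH_mul_left {n : ℕ} (α σ τ : Equiv.Perm (Fin n)) : dH (α * σ) (α * τ) = dH σ τ := by
  simp [dH]

theorem dH_mul_right {n : ℕ} (σ τ β : Equiv.Perm (Fin n)) : dH (σ * β) (τ * β) = dH σ τ := by
  unfold dH
  congr 1
  refine Finset.card_bij (fun i _ => β i) ?_ (fun i _ k _ h => β.injective h) ?_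
  · intro i hi
    exact Finset.mem_filter.mpr ⟨Finset.mem_univ _, (Finset.mem_filter.mp hi).2⟩
  · intro i hi
    refine ⟨β.symm i, Finset.mem_filter.mpr ⟨Finset.mem_univ _, ?_⟩, β.apply_symm_apply i⟩
    simpa using (Finset.mem_filter.mp hi).2

theorem dH_self {n : ℕ} (σ : Equiv.Perm (Fin n)) : dH σ σ = 0 := by
  simp [dH]

theorem dH_le_size {n : ℕ} (σ τ : Equiv.Perm (Fin n)) : dH σ τ ≤ n := by
  unfold dH
  exact_mod_cast (Finset.card_le_univ _).trans_eq (Fintype.card_fin n)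

theorem dH_one_right {n : ℕ} (σ : Equiv.Perm (Fin n)) : dH σ 1 = degree σ := by
  unfold dH degree
  congr!

theorem dH_comm {n : ℕ} (σ τ : Equiv.Perm (Fin n)) : dH σ τ = dH τ σ := by
  simp only [dH, ne_comm]

theorem dH_one_left {n : ℕ} (σ : Equiv.Perm (Fin n)) : dH 1 σ = degree σ := by
  rw [dH_comm, dH_one_right]

/-- Two permutations moving a common point differ in fewer places than the sum of their degrees. -/
theorem dH_add_one_le_degree_add_degree {n : ℕ} {σ τ : Equiv.Perm (Fin n)} {j : Fin n}
    (hσ : σ j ≠ j) (hτ : τ j ≠ j) : dH σ τ + 1 ≤ degree σ + degree τ := by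
  unfold dH degree
  set A := Finset.univ.filter fun i => σ i ≠ i
  set B := Finset.univ.filter fun i => τ i ≠ i
  have hsub : (Finset.univ.filter fun i => σ i ≠ τ i) ⊆ A ∪ B := by
    intro i hi
    simp only [Finset.mem_filter, Finset.mem_univ, true_and, Finset.mem_union, A, B] at hi ⊢
    by_contra! h
    exact hi (h.1.trans h.2.symm)
  have h1 := Finset.card_le_card hsub
  have h2 := Finset.card_union_add_card_inter A B
  have h3 : 0 < (A ∩ B).card := Finset.card_pos.mpr ⟨j, by simp [A, B, hσ, hτ]⟩
  have h4 : (Finset.univ.filter fun i => σ i ≠ τ i).card + 1 ≤ A.card + B.card := by omega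
  norm_cast

theorem zero_notMem_drop_one_finRange {n : ℕ} {j : Fin n}
    (hj : j ∈ (List.finRange n).drop 1) : (j : ℕ) ≠ 0 := by
  cases n with
  | zero => exact j.elim0
  | succ m =>
    rw [List.finRange_succ] at hj
    simp only [List.drop_succ_cons, List.drop_zero, List.mem_map] at hj
    obtain ⟨k, -, rfl⟩ := hj
    simp

namespace IsLocalBase

variable {n ℓ : ℕ} {G : Subgroup (Equiv.Perm (Fin n))} {t : Fin n → Fin n → Equiv.Perm (Fin n)}

theorem mem (ht : IsLocalBase ℓ G t) {i j : Fin n} (hj : (j : ℕ) ≠ 0) (hi : i ∈ Orb G j) :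
    t i j ∈ G := by
  by_cases h : i = j
  · rw [h, (ht j hj).1]
    exact G.one_mem
  · exact ((ht j hj).2 i hi h).1.1

theorem UT_mem (ht : IsLocalBase ℓ G t) {x : Fin n → Fin n} (hx : ∀ j, x j ∈ Orb G j) :
    UT t x ∈ G := by
  refine G.list_prod_mem fun σ hσ => ?_
  obtain ⟨j, hj, rfl⟩ := List.mem_map.mp hσ
  exact ht.mem (zero_notMem_drop_one_finRange hj) (hx j)

theorem dH_le (ht : IsLocalBase ℓ G t) (hℓ : 1 ≤ ℓ) {i k j : Fin n} (hj : (j : ℕ) ≠ 0)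
    (hi : i ∈ Orb G j) (hk : k ∈ Orb G j) :
    dH (t i j) (t k j) ≤ min (2 * (ℓ : ℝ) - 1) n := by
  refine le_min ?_ (dH_le_size _ _)
  have hℓ' : (1 : ℝ) ≤ ℓ := by exact_mod_cast hℓ
  have hmoves : ∀ i ∈ Orb G j, i ≠ j → t i j j ≠ j := fun i hi hij h =>
    hij ((t i j).injective (((ht j hj).2 i hi hij).2.1.trans h.symm))
  have hdeg : ∀ i ∈ Orb G j, i ≠ j → (degree (t i j) : ℝ) ≤ ℓ := fun i hi hij => by
    exact_mod_cast ((ht j hj).2 i hi hij).2.2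
  by_cases hij : i = j <;> by_cases hkj : k = j
  · rw [hij, hkj, dH_self]
    linarith
  · rw [hij, (ht j hj).1, dH_one_left]
    linarith [hdeg k hk hkj]
  · rw [hkj, (ht j hj).1, dH_one_right]
    linarith [hdeg i hi hij]
  · linarith [hdeg i hi hij, hdeg k hk hkj,
      dH_add_one_le_degree_add_degree (hmoves i hi hij) (hmoves k hk hkj)]

end IsLocalBase

/-- Changing one factor of a product over a duplicate-free list moves it no further than the
factor itself moves. -/
theorem dH_list_prod_of_eq_off {n : ℕ} {ι : Type*} {l : List ι} (hl : l.Nodup) {j : ι}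
    (hj : j ∈ l) {u v : ι → Equiv.Perm (Fin n)} (huv : ∀ k, k ≠ j → u k = v k) :
    dH (l.map u).prod (l.map v).prod = dH (u j) (v j) := by
  obtain ⟨A, B, rfl⟩ := List.append_of_mem hj
  have hnd := List.nodup_middle.mp hl
  rw [List.nodup_cons, List.mem_append, not_or] at hnd
  have hmap : ∀ L : List ι, j ∉ L → L.map u = L.map v := fun L hL =>
    List.map_congr_left fun k hk => huv k fun h => hL (h ▸ hk)
  simp only [List.map_append, List.map_cons, List.prod_append, List.prod_cons,
    hmap A hnd.1.1, hmap B hnd.1.2, dH_mul_left, dH_mul_right]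

theorem sum_mul_of_pushforward {ι κ : Type*} [Fintype ι] [Fintype κ] [DecidableEq κ] (U : ι → κ) (p : ι → ℝ)
    (μ F : κ → ℝ) (hμ : ∀ σ, μ σ = ∑ x, if U x = σ then p x else 0) :
    ∑ σ, F σ * μ σ = ∑ x, p x * F (U x) := by
  simp only [hμ, Finset.mul_sum]
  rw [Finset.sum_comm]
  refine Finset.sum_congr rfl fun x _ => ?_
  simp [mul_comm]

/-- Dual (Hoeffding-type) formulation of the `W₁` transport-entropy inequality for
measures of the class `M_T`. -/
theorem stmt15 {n ℓ : ℕ} (hn : 2 ≤ n) (hℓ : 2 ≤ ℓ) (hℓn : ℓ ≤ n)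
    (G : Subgroup (Equiv.Perm (Fin n))) (t : Fin n → Fin n → Equiv.Perm (Fin n))
    (ht : IsLocalBase ℓ G t) (μ : Equiv.Perm (Fin n) → ℝ) (hμ : MemMT G t μ)
    (φ : Equiv.Perm (Fin n) → ℝ)
    (hφ : ∀ σ ∈ G, ∀ τ ∈ G, |φ σ - φ τ| ≤ dH σ τ)
    (lam : ℝ) (hlam : 0 ≤ lam) :
    ∑ σ, Real.exp (lam * φ σ) * μ σ ≤
      Real.exp (lam * ∑ σ, φ σ * μ σ +
        (Kn G : ℝ) * (min (2 * (ℓ : ℝ) - 1) (n : ℝ)) ^ 2 * lam ^ 2 / 8) := by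
  obtain ⟨w, hw, hμ⟩ := hμ
  have hpush (F : Equiv.Perm (Fin n) → ℝ) :
      ∑ σ, F σ * μ σ = ∑ x : Fin n → Fin n, (∏ j, w j (x j)) * F (UT t x) :=
    sum_mul_of_pushforward (UT t) (fun x => ∏ j, w j (x j)) μ F fun σ => hμ σ
  have horb : ∀ j i, w j i ≠ 0 → i ∈ Orb G j := fun j i h =>
    by_contra fun hi => h ((hw j).2.1 i hi)
  set C := min (2 * (ℓ : ℝ) - 1) (n : ℝ) with hC
  have hC0 : 0 ≤ C := by
    have hℓ' : (2 : ℝ) ≤ ℓ := by exact_mod_cast hℓ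
    exact le_min (by linarith) (Nat.cast_nonneg n)
  let active : Fin n → Prop := fun j => (j : ℕ) ≠ 0 ∧ Orb G j ≠ {j}
  let c : Fin n → ℝ := fun j => if active j then lam * C else 0
  have hmain := sum_prod_mul_exp_le_of_bounded_differences w c (fun x => lam * φ (UT t x))
    (fun j => (hw j).1) (fun j => (hw j).2.2) ?_
  · have hsq : ∑ j, c j ^ 2 = Kn G * (lam * C) ^ 2 := by
      simp only [c, ite_pow, ne_eq, OfNat.ofNat_ne_zero, not_false_eq_true, zero_pow]
      rw [← Finset.sum_filter, Finset.sum_const, nsmul_eq_mul]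
      rfl
    rw [hpush, hpush fun σ => φ σ]
    refine hmain.trans (le_of_eq ?_)
    rw [hsq, Finset.mul_sum]
    congr 2
    · exact Finset.sum_congr rfl fun x _ => by ring
    · ring
  · intro j x y hx hy hxy
    have hx' : ∀ k, x k ∈ Orb G k := fun k => horb k _ (hx k)
    have hy' : ∀ k, y k ∈ Orb G k := fun k => horb k _ (hy k)
    have hlip : |lam * φ (UT t x) - lam * φ (UT t y)| ≤ lam * dH (UT t x) (UT t y) := by
      rw [← mul_sub, abs_mul, abs_of_nonneg hlam]
      exact mul_le_mul_of_nonneg_left (hφ _ (ht.UT_mem hx') _ (ht.UT_mem hy')) hlam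
    refine hlip.trans ?_
    have hoff : ∀ k, k ≠ j → t (x k) k = t (y k) k := fun k hk => by rw [hxy k hk]
    by_cases hj : j ∈ (List.finRange n).drop 1
    · have hj0 := zero_notMem_drop_one_finRange hj
      have hd : dH (UT t x) (UT t y) = dH (t (x j) j) (t (y j) j) :=
        dH_list_prod_of_eq_off ((List.nodup_finRange n).sublist (List.drop_sublist 1 _)) hj hoff
      rw [hd]
      by_cases ho : Orb G j = {j}
      · have hxj : x j = j := by simpa [ho] using hx' j
        have hyj : y j = j := by simpa [ho] using hy' j
        simp [c, active, ho, hxj, hyj, dH_self]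
      · simp only [c, active, ne_eq, hj0, ho, not_false_eq_true, and_self, if_true]
        exact mul_le_mul_of_nonneg_left (ht.dH_le (by omega) hj0 (hx' j) (hy' j)) hlam
    · have heq : UT t x = UT t y := by
        unfold UT
        congr 1
        exact List.map_congr_left fun k hk => hoff k fun h => hj (h ▸ hk)
      rw [heq, dH_self, mul_zero]
      simp only [c]
      split_ifs
      · exact mul_nonneg hlam hC0
      · exact le_rfl

end
end

section
/- Let n ≥ 1, k ∈ {0,…,n}, and let P : S_n → X_{k,n−k} be defined by P(σ) = the indicator vector of σ({1,…,k}), i.e. P(σ)_i = 1 if i ∈ {σ(1),…,σ(k)} and 0 otherwise. For g : S_n → ℝ define ⌢Q g(σ) = inf over probability measures p on S_n of ( ∑_τ g(τ)p(τ) + (1/8) ∑_{j=1}^n ( ∑_τ p(τ)·1_{σ(j)≠τ(j)} )² ), and for f : X_{k,n−k} → ℝ define Q̂ f(x) = inf over probability measures q on X_{k,n−k} of ( ∑_y f(y)q(y) + (1/8) ∑_{i=1}^n ( ∑_y q(y)·1_{x_i≠y_i} )² ). Then for every f : X_{k,n−k} → ℝ and every σ ∈ S_n, ⌢Q (f∘P)(σ)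 ≥ Q̂ f(P(σ)). -/
attribute [local instance] Classical.propDecidable

noncomputable section

/-- The cubeSlice `X_{k, n-k}` of the discrete cube `{0,1}^n`. -/
def cubeSlice (n k : ℕ) : Set (Fin n → Bool) :=
  {x | (Finset.univ.filter fun i => x i = true).card = k}

/-- The projection `P : S_n → X_{k, n-k}`, `P(σ) = the indicator of σ({1, ..., k})`. -/
noncomputable def Pmap {n : ℕ} (k : ℕ) (σ : Equiv.Perm (Fin n)) : Fin n → Bool :=
  fun i => decide (∃ j : Fin n, (j : ℕ) < k ∧ σ j = i)

/-- The infimum-convolution operator `⌒Q g` on the symmetric group. -/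
noncomputable def Qparen {n : ℕ} (g : Equiv.Perm (Fin n) → ℝ)
    (σ : Equiv.Perm (Fin n)) : ℝ :=
  sInf {w | ∃ p : Equiv.Perm (Fin n) → ℝ, (∀ τ, 0 ≤ p τ) ∧ (∑ τ, p τ = 1) ∧
    w = (∑ τ, g τ * p τ) + (1 / 8) * ∑ j : Fin n,
      (∑ τ, p τ * (if σ j ≠ τ j then (1 : ℝ) else 0)) ^ 2}

/-- The infimum-convolution operator `Q̂ f` on the cubeSlice of the discrete cube. -/
noncomputable def Qhat {n : ℕ} (k : ℕ) (f : (Fin n → Bool) → ℝ)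
    (x : Fin n → Bool) : ℝ :=
  sInf {w | ∃ q : (Fin n → Bool) → ℝ,
    (∀ y, 0 ≤ q y) ∧ (∀ y, y ∉ cubeSlice n k → q y = 0) ∧ (∑ y, q y = 1) ∧
    w = (∑ y, f y * q y) + (1 / 8) * ∑ i : Fin n,
      (∑ y, q y * (if x i ≠ y i then (1 : ℝ) else 0)) ^ 2}

/-- If `σ` and `τ` agree at `j`, their projections to the slice agree at coordinate `σ j`. -/
theorem Pmap_apply_eq_of_apply_eq {n : ℕ} (k : ℕ) {σ τ : Equiv.Perm (Fin n)} {j : Fin n}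
    (h : σ j = τ j) : Pmap k σ (σ j) = Pmap k τ (σ j) := by
  have key : ∀ ρ : Equiv.Perm (Fin n),
      (∃ l : Fin n, (l : ℕ) < k ∧ ρ l = ρ j) ↔ (j : ℕ) < k := fun ρ =>
    ⟨fun ⟨l, hl, e⟩ => ρ.injective e ▸ hl, fun hj => ⟨j, hj, rfl⟩⟩
  have h₁ : Pmap k σ (σ j) = decide ((j : ℕ) < k) := decide_eq_decide.2 (key σ)
  have h₂ : Pmap k τ (τ j) = decide ((j : ℕ) < k) := decide_eq_decide.2 (key τ)
  rw [h₁, h, h₂]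

theorem Pmap_mem_cubeSlice {n k : ℕ} (hk : k ≤ n) (σ : Equiv.Perm (Fin n)) :
    Pmap k σ ∈ cubeSlice n k := by
  have h : (Finset.univ.filter fun i => Pmap k σ i = true) =
      (Finset.univ.filter fun j : Fin n => (j : ℕ) < k).map σ.toEmbedding := by
    ext i
    simp only [Pmap, Finset.mem_filter_univ, decide_eq_true_eq, Finset.mem_map]
    rfl
  change (Finset.univ.filter fun i => Pmap k σ i = true).card = k
  rw [h, Finset.card_map, Fin.card_filter_val_lt, min_eq_right hk]

theorem bddBelow_Qhat {n : ℕ} (k : ℕ) (f : (Fin n → Bool) → ℝ) (x : Fin n → Bool) :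
    BddBelow {w | ∃ q : (Fin n → Bool) → ℝ,
      (∀ y, 0 ≤ q y) ∧ (∀ y, y ∉ cubeSlice n k → q y = 0) ∧ (∑ y, q y = 1) ∧
      w = (∑ y, f y * q y) + (1 / 8) * ∑ i : Fin n,
        (∑ y, q y * (if x i ≠ y i then (1 : ℝ) else 0)) ^ 2} := by
  refine ⟨-∑ y, |f y|, ?_⟩
  rintro w ⟨q, hq, -, hsum, rfl⟩
  have h₁ : -∑ y, |f y| ≤ ∑ y, f y * q y := by
    rw [← Finset.sum_neg_distrib]
    refine Finset.sum_le_sum fun y _ => ?_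
    have hle : q y ≤ 1 := hsum ▸ Finset.single_le_sum (fun z _ => hq z) (Finset.mem_univ y)
    nlinarith [neg_abs_le (f y), abs_nonneg (f y), hq y]
  have h₂ : 0 ≤ ∑ i : Fin n, (∑ y, q y * (if x i ≠ y i then (1 : ℝ) else 0)) ^ 2 :=
    Finset.sum_nonneg fun i _ => sq_nonneg _
  linarith

/-- Change of variables for the pushforward of a finite weight `p` under a map `φ`. -/
theorem sum_mul_sum_fiber {α β : Type*} [Fintype α] [Fintype β] [DecidableEq β]
    (φ : α → β) (p : α → ℝ) (g : β → ℝ) :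
    ∑ y, (∑ a, if φ a = y then p a else 0) * g y = ∑ a, p a * g (φ a) := by
  simp_rw [Finset.sum_mul, ite_mul, zero_mul]
  rw [Finset.sum_comm]
  simp

/-- Lemma `tartine`: `⌒Q (f ∘ P)(σ) ≥ Q̂ f (P σ)`. -/
theorem stmt18 {n k : ℕ} (hn : 1 ≤ n) (hk : k ≤ n)
    (f : (Fin n → Bool) → ℝ) (σ : Equiv.Perm (Fin n)) :
    Qhat k f (Pmap k σ) ≤ Qparen (fun τ => f (Pmap k τ)) σ := by
  refine le_csInf ⟨_, Pi.single σ 1, fun τ => ?_, by simp, rfl⟩ ?_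
  · by_cases h : τ = σ <;> simp [h]
  rintro w ⟨p, hp, hsum, rfl⟩
  refine (csInf_le (bddBelow_Qhat k f _)
    ⟨fun y => ∑ τ, if Pmap k τ = y then p τ else 0, fun y => ?_, fun y hy => ?_, ?_, rfl⟩).trans ?_
  · exact Finset.sum_nonneg fun τ _ => by split_ifs <;> simp [hp]
  · refine Finset.sum_eq_zero fun τ _ => if_neg ?_
    rintro rfl
    exact hy (Pmap_mem_cubeSlice hk τ)
  · simpa [hsum] using sum_mul_sum_fiber (Pmap k) p fun _ => 1
  have hf : ∑ y, f y * (∑ τ, if Pmap k τ = y then p τ else 0) = ∑ τ, f (Pmap k τ) * p τ := by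
    simpa only [mul_comm] using sum_mul_sum_fiber (Pmap k) p f
  rw [hf]
  gcongr ?_ + 1 / 8 * ?_
  · exact le_rfl
  rw [← Equiv.sum_comp σ]
  refine Finset.sum_le_sum fun j _ => ?_
  rw [sum_mul_sum_fiber (Pmap k) p fun y => if Pmap k σ (σ j) ≠ y (σ j) then (1 : ℝ) else 0]
  refine pow_le_pow_left₀ (Finset.sum_nonneg fun τ _ => ?_) (Finset.sum_le_sum fun τ _ => ?_) 2
  · exact mul_nonneg (hp τ) (by split_ifs <;> norm_num)
  · refine mul_le_mul_of_nonneg_left ?_ (hp τ)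
    by_cases h : σ j = τ j
    · simp [if_neg (not_not.2 h), Pmap_apply_eq_of_apply_eq k h]
    · rw [if_pos h]
      split_ifs <;> norm_num

end
end
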